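/- arXiv:1007.4152 — 4 statements merged into one kernel-verified Lean document; each statement's English description precedes it below -/
import Mathlib

section
/- Let f : [0,∞) → ℝ be continuous on [0,∞) and differentiable on (0,∞), and suppose its derivative f′ is operator antitone on (0,∞). Then for every m and all m×m real symmetric positive semidefinite matrices X, Y, Z, one has trace f(X+Y+Z) + trace f(Z) ≤ trace f(X+Z) + trace f(Y+Z), where f is applied to a symmetric matrix via its spectral decomposition (f applied to each eigenvalue). -/
open Matrix in
/-- Applying a real function to a real symmetric matrix via the spectral
decomposition: `f(A) = U Diag(f(λ₁),…,f(λ_m)) Uᵀ`. Junk value `0` on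
non-symmetric input. -/
noncomputable def matFun (f : ℝ → ℝ) {m : ℕ} (A : Matrix (Fin m) (Fin m) ℝ) :
    Matrix (Fin m) (Fin m) ℝ :=
  if hA : A.IsHermitian then
    (hA.eigenvectorUnitary : Matrix (Fin m) (Fin m) ℝ) *
      Matrix.diagonal (fun i => f (hA.eigenvalues i)) *
      star (hA.eigenvectorUnitary : Matrix (Fin m) (Fin m) ℝ)
  else 0

/-- `g` is operator antitone on `(0,∞)` : for every dimension `m` and all
positive definite matrices `A ⪯ B` (Löwner order, i.e. `B - A` positive
semidefinite), the matrix `g(A) - g(B)` is positive semidefinite. -/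
def OperatorAntitoneOn (g : ℝ → ℝ) : Prop :=
  ∀ (m : ℕ) (A B : Matrix (Fin m) (Fin m) ℝ), A.PosDef → B.PosDef →
    (B - A).PosSemidef → (matFun g A - matFun g B).PosSemidef

namespace Matrix

variable {m : ℕ} {A B : Matrix (Fin m) (Fin m) ℝ}

theorem IsHermitian.matFun_eq (hA : A.IsHermitian) (f : ℝ → ℝ) :
    matFun f A = (hA.eigenvectorUnitary : Matrix (Fin m) (Fin m) ℝ) *
      diagonal (fun i => f (hA.eigenvalues i)) *
      star (hA.eigenvectorUnitary : Matrix (Fin m) (Fin m) ℝ) :=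
  dif_pos hA

theorem IsHermitian.matFun_id (hA : A.IsHermitian) : matFun (fun x => x) A = A := by
  rw [hA.matFun_eq]
  exact hA.spectral_theorem.symm

theorem IsHermitian.matFun_one (hA : A.IsHermitian) : matFun (fun _ => 1) A = 1 := by
  rw [hA.matFun_eq, diagonal_one, mul_one]
  exact Unitary.mul_star_self_of_mem hA.eigenvectorUnitary.2

theorem IsHermitian.matFun_mul_matFun (hA : A.IsHermitian) (g h : ℝ → ℝ) :
    matFun g A * matFun h A = matFun (fun x => g x * h x) A := by
  have hU := Unitary.star_mul_self_of_mem hA.eigenvectorUnitary.2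
  simp only [hA.matFun_eq, ← diagonal_mul_diagonal, mul_assoc]
  rw [← mul_assoc (star _) _ (_ * star _), hU, one_mul]

theorem IsHermitian.trace_matFun (hA : A.IsHermitian) (f : ℝ → ℝ) :
    (matFun f A).trace = ∑ i, f (hA.eigenvalues i) := by
  rw [hA.matFun_eq, trace_mul_cycle, Unitary.star_mul_self_of_mem hA.eigenvectorUnitary.2,
    one_mul, trace_diagonal]

theorem IsHermitian.matFun_eval (hA : A.IsHermitian) (p : Polynomial ℝ) :
    matFun (fun x => p.eval x) A = Polynomial.aeval A p := by
  conv_rhs => rw [hA.spectral_theorem]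
  rw [Polynomial.aeval_algHom_apply, hA.matFun_eq, Unitary.conjStarAlgAut_apply,
    ← diagonalAlgHom_apply ℝ (RCLike.ofReal ∘ hA.eigenvalues), Polynomial.aeval_algHom_apply]
  congr 2
  rw [diagonalAlgHom_apply]
  congr 1
  ext i
  simp [Polynomial.aeval_fn_apply]

theorem IsHermitian.trace_matFun_mul_matFun (hA : A.IsHermitian) (hB : B.IsHermitian)
    (g h : ℝ → ℝ) :
    (matFun g A * matFun h B).trace =
      ∑ i, ∑ j, ((star (hA.eigenvectorUnitary : Matrix (Fin m) (Fin m) ℝ) *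
        (hB.eigenvectorUnitary : Matrix (Fin m) (Fin m) ℝ)) i j) ^ 2 *
        (g (hA.eigenvalues i) * h (hB.eigenvalues j)) := by
  rw [hA.matFun_eq, hB.matFun_eq]
  set U := (hA.eigenvectorUnitary : Matrix (Fin m) (Fin m) ℝ)
  set V := (hB.eigenvectorUnitary : Matrix (Fin m) (Fin m) ℝ)
  set D := diagonal (fun i => g (hA.eigenvalues i))
  set E := diagonal (fun i => h (hB.eigenvalues i))
  have key : (U * D * star U * (V * E * star V)).trace =
      (D * (star U * V) * E * star (star U * V)).trace := by
    rw [show U * D * star U * (V * E * star V) = U * (D * star U * V * E * star V) by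
      simp only [mul_assoc], trace_mul_comm]
    simp only [mul_assoc, star_mul, star_star]
  rw [key, trace]
  refine Finset.sum_congr rfl fun i _ => ?_
  rw [diag_apply, mul_apply]
  refine Finset.sum_congr rfl fun j _ => ?_
  simp only [D, E, mul_diagonal, diagonal_mul, star_apply, star_trivial]
  ring

/-- **Klein's inequality**. -/
theorem PosDef.trace_matFun_sub_le (hA : A.PosDef) (hB : B.PosDef) {f g : ℝ → ℝ}
    (hfg : ∀ a b, 0 < a → 0 < b → f b - f a ≤ (b - a) * g a) :
    (matFun f B).trace - (matFun f A).trace ≤ ((B - A) * matFun g A).trace := by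
  have hA' := hA.isHermitian
  have hB' := hB.isHermitian
  have h₁ := hA'.trace_matFun_mul_matFun hB' (fun _ => 1) f
  have h₂ := hA'.trace_matFun_mul_matFun hB' f (fun _ => 1)
  have h₃ := hA'.trace_matFun_mul_matFun hB' g (fun x => x)
  have h₄ := hA'.trace_matFun_mul_matFun hB' (fun x => g x * x) (fun _ => 1)
  have h₅ : matFun g A * A = matFun (fun x => g x * x) A := by
    simpa only [hA'.matFun_id] using hA'.matFun_mul_matFun g (fun x => x)
  rw [hA'.matFun_one, one_mul] at h₁
  rw [hB'.matFun_one, mul_one] at h₂ h₄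
  rw [hB'.matFun_id] at h₃
  rw [trace_mul_comm, mul_sub, trace_sub, h₃, h₅, h₄, h₁, h₂]
  simp only [← Finset.sum_sub_distrib, ← mul_sub]
  refine Finset.sum_le_sum fun i _ => Finset.sum_le_sum fun j _ => ?_
  refine mul_le_mul_of_nonneg_left ?_ (sq_nonneg _)
  linarith [hfg _ _ (hA.eigenvalues_pos i) (hB.eigenvalues_pos j)]

theorem PosSemidef.trace_mul_nonneg (hA : A.PosSemidef) (hB : B.PosSemidef) :
    0 ≤ (A * B).trace := by
  obtain ⟨C, rfl⟩ : ∃ C : Matrix (Fin m) (Fin m) ℝ, A = Cᴴ * C := by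
    open scoped MatrixOrder Matrix.Norms.L2Operator in
    exact CStarAlgebra.nonneg_iff_eq_star_mul_self.mp hA.nonneg
  rw [mul_assoc, trace_mul_comm]
  exact (hB.mul_mul_conjTranspose_same C).trace_nonneg

theorem continuousOn_trace_matFun {f : ℝ → ℝ} (hf : ContinuousOn f (Set.Ici 0)) :
    ContinuousOn (fun A : Matrix (Fin m) (Fin m) ℝ => (matFun f A).trace)
      {A | A.PosSemidef} := by
  refine continuousOn_of_locally_uniform_approx_of_continuousWithinAt fun A hA u hu => ?_
  obtain ⟨ε, hε, hu⟩ := Metric.mem_uniformity_dist.1 hu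
  have hm : (0 : ℝ) < m + 1 := by positivity
  obtain ⟨p, hp⟩ := exists_polynomial_near_of_continuousOn 0 (A.trace + 1) f
    (hf.mono Set.Icc_subset_Ici_self) (ε / (m + 1)) (by positivity)
  refine ⟨{B | B.PosSemidef ∧ B.trace < A.trace + 1}, ?_,
    fun B => (Polynomial.aeval B p).trace, ?_, ?_⟩
  · refine Filter.inter_mem self_mem_nhdsWithin (mem_nhdsWithin_of_mem_nhds ?_)
    have : Continuous fun B : Matrix (Fin m) (Fin m) ℝ => B.trace := by fun_prop
    exact this.continuousAt.eventually_lt continuousAt_const (by simp)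
  · exact (Continuous.matrix_trace (p.continuous_aeval)).continuousWithinAt
  · rintro B ⟨hB, hBA⟩
    refine hu ?_
    have hB' := hB.isHermitian
    beta_reduce
    rw [← hB'.matFun_eval, hB'.trace_matFun, hB'.trace_matFun, Real.dist_eq,
      ← Finset.sum_sub_distrib]
    have htr : B.trace = ∑ i, hB'.eigenvalues i := by simpa using hB'.trace_eq_sum_eigenvalues
    calc _ ≤ ∑ i, |f (hB'.eigenvalues i) - p.eval (hB'.eigenvalues i)| :=
          Finset.abs_sum_le_sum_abs _ _
      _ ≤ ∑ _i : Fin m, ε / (m + 1) := by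
          refine Finset.sum_le_sum fun i _ => ?_
          rw [abs_sub_comm]
          refine (hp _ ⟨hB.eigenvalues_nonneg i, ?_⟩).le
          have := Finset.single_le_sum (fun j _ => hB.eigenvalues_nonneg j) (Finset.mem_univ i)
          linarith
      _ < ε := by
          rw [Finset.sum_const, Finset.card_univ, Fintype.card_fin, nsmul_eq_mul, ← mul_div_assoc,
            div_lt_iff₀ hm]
          linarith

end Matrix

theorem OperatorAntitoneOn.antitoneOn {g : ℝ → ℝ} (hg : OperatorAntitoneOn g) :
    AntitoneOn g (Set.Ioi 0) := by
  have herm (a : ℝ) : (a • (1 : Matrix (Fin 1) (Fin 1) ℝ)).IsHermitian := by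
    simp [Matrix.IsHermitian]
  have htr (a : ℝ) : (matFun g (a • (1 : Matrix (Fin 1) (Fin 1) ℝ))).trace = g a := by
    have := (herm a).trace_eq_sum_eigenvalues
    simp at this
    rw [(herm a).trace_matFun]
    simp [← this]
  intro a ha b hb hab
  have := (hg 1 (a • 1) (b • 1) (Matrix.PosDef.one.smul ha) (Matrix.PosDef.one.smul hb)
    (by rw [← sub_smul]; exact Matrix.PosSemidef.one.smul (sub_nonneg.2 hab))).trace_nonneg
  rw [Matrix.trace_sub, htr, htr] at this
  linarith

theorem sub_le_mul_deriv_of_antitoneOn_deriv {f : ℝ → ℝ}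
    (hf : DifferentiableOn ℝ f (Set.Ioi 0)) (hf' : AntitoneOn (deriv f) (Set.Ioi 0))
    (a b : ℝ) (ha : 0 < a) (hb : 0 < b) : f b - f a ≤ (b - a) * deriv f a := by
  rcases lt_trichotomy a b with h | rfl | h
  · obtain ⟨c, hc, hc'⟩ := exists_deriv_eq_slope f h
      (hf.continuousOn.mono fun x hx => ha.trans_le hx.1)
      (hf.mono fun x hx => ha.trans hx.1)
    rw [eq_div_iff (sub_pos.2 h).ne'] at hc'
    nlinarith [hf' (Set.mem_Ioi.2 ha) (ha.trans hc.1) hc.1.le]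
  · simp
  · obtain ⟨c, hc, hc'⟩ := exists_deriv_eq_slope f h
      (hf.continuousOn.mono fun x hx => hb.trans_le hx.1)
      (hf.mono fun x hx => hb.trans hx.1)
    rw [eq_div_iff (sub_pos.2 h).ne'] at hc'
    nlinarith [hf' (hb.trans hc.1) (Set.mem_Ioi.2 ha) hc.2.le]

theorem trace_matFun_add_smul_sub_le {m : ℕ} {f : ℝ → ℝ}
    (hf : DifferentiableOn ℝ f (Set.Ioi 0)) (hf' : OperatorAntitoneOn (deriv f))
    {A B X : Matrix (Fin m) (Fin m) ℝ} (hA : A.PosDef) (hX : X.PosSemidef)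
    (hAB : (B - A).PosSemidef) {h : ℝ} (hh : 0 ≤ h) :
    (matFun f (B + h • X + h • X)).trace - (matFun f (B + h • X)).trace ≤
      (matFun f (A + h • X)).trace - (matFun f A).trace := by
  have hhX : (h • X).PosSemidef := hX.smul hh
  have hB : B.PosDef := by simpa using hA.add_posSemidef hAB
  have hA₁ := hA.add_posSemidef hhX
  have hB₁ := hB.add_posSemidef hhX
  have hfg := sub_le_mul_deriv_of_antitoneOn_deriv hf hf'.antitoneOn
  have h₁ := hB₁.trace_matFun_sub_le (hB₁.add_posSemidef hhX) hfg
  have h₂ := hA₁.trace_matFun_sub_le hA hfg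
  have h₃ := hhX.trace_mul_nonneg (hf' m _ _ hA₁ hB₁ (by simpa using hAB))
  rw [add_sub_cancel_left] at h₁
  rw [show A - (A + h • X) = -(h • X) by abel, neg_mul, Matrix.trace_neg] at h₂
  rw [mul_sub, Matrix.trace_sub] at h₃
  linarith

theorem trace_matFun_add_nsmul_smul_sub_le {m : ℕ} {f : ℝ → ℝ}
    (hf : DifferentiableOn ℝ f (Set.Ioi 0)) (hf' : OperatorAntitoneOn (deriv f))
    {A B X : Matrix (Fin m) (Fin m) ℝ} (hA : A.PosDef) (hX : X.PosSemidef)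
    (hAB : (B - A).PosSemidef) {h : ℝ} (hh : 0 ≤ h) (n : ℕ) :
    (matFun f (B + h • X + (n * h) • X)).trace - (matFun f (B + h • X)).trace ≤
      (matFun f (A + (n * h) • X)).trace - (matFun f A).trace := by
  induction n with
  | zero => simp
  | succ n ih =>
    have hn : 0 ≤ n * h := by positivity
    have := trace_matFun_add_smul_sub_le hf hf' (A := A + (n * h) • X) (B := B + (n * h) • X)
      (hA.add_posSemidef (hX.smul hn)) hX (by simpa using hAB) hh
    rw [show B + (n * h) • X + h • X = B + h • X + (n * h) • X by abel] at this
    push_cast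
    simp only [add_mul, one_mul, add_smul, ← add_assoc]
    linarith

/-- If `f` is continuous on `[0,∞)`, differentiable on `(0,∞)`,
and its derivative is operator antitone on `(0,∞)`, then for all positive
semidefinite `X Y Z`,
`trace f(X+Y+Z) + trace f(Z) ≤ trace f(X+Z) + trace f(Y+Z)`. -/
theorem trace_matFun_add_add_le (f : ℝ → ℝ)
    (hf_cont : ContinuousOn f (Set.Ici (0 : ℝ)))
    (hf_diff : DifferentiableOn ℝ f (Set.Ioi (0 : ℝ)))
    (hf'_anti : OperatorAntitoneOn (deriv f))
    (m : ℕ) (X Y Z : Matrix (Fin m) (Fin m) ℝ)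
    (hX : X.PosSemidef) (hY : Y.PosSemidef) (hZ : Z.PosSemidef) :
    (matFun f (X + Y + Z)).trace + (matFun f Z).trace ≤
      (matFun f (X + Z)).trace + (matFun f (Y + Z)).trace := by
  let ε : ℕ → ℝ := fun n => 1 / ((n : ℝ) + 1)
  have hε : Filter.Tendsto ε Filter.atTop (nhds 0) := tendsto_one_div_add_atTop_nhds_zero_nat
  have hε_pos (n : ℕ) : 0 < ε n := Nat.one_div_pos_of_nat
  have key (n : ℕ) :
      (matFun f (Y + Z + ε n • 1 + ε n • X + X)).trace -
          (matFun f (Y + Z + ε n • 1 + ε n • X)).trace ≤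
        (matFun f (Z + ε n • 1 + X)).trace - (matFun f (Z + ε n • 1)).trace := by
    have hZ' : (Z + ε n • 1).PosDef := (Matrix.PosDef.one.smul (hε_pos n)).posSemidef_add hZ
    have := trace_matFun_add_nsmul_smul_sub_le hf_diff hf'_anti (B := Y + Z + ε n • 1) hZ' hX
      (by rwa [show Y + Z + ε n • 1 - (Z + ε n • 1) = Y by abel]) (hε_pos n).le (n + 1)
    have hn : ((n + 1 : ℕ) : ℝ) * ε n = 1 := by
      have : (n : ℝ) + 1 ≠ 0 := by positivity
      simp only [ε]
      push_cast
      field_simp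
    rwa [hn, one_smul] at this
  have lim {W V : Matrix (Fin m) (Fin m) ℝ} (hW : W.PosSemidef) (hV : V.PosSemidef) :
      Filter.Tendsto (fun n => (matFun f (W + ε n • V)).trace) Filter.atTop
        (nhds (matFun f W).trace) := by
    refine (Matrix.continuousOn_trace_matFun hf_cont W hW).tendsto.comp
      (tendsto_nhdsWithin_iff.2 ⟨?_, Filter.Eventually.of_forall fun n =>
        hW.add (hV.smul (hε_pos n).le)⟩)
    simpa using (hε.smul_const V).const_add W
  have h1 : (1 : Matrix (Fin m) (Fin m) ℝ).PosSemidef := .one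
  have := le_of_tendsto_of_tendsto'
    ((lim ((hX.add hY).add hZ) (h1.add hX)).sub (lim (hY.add hZ) (h1.add hX)))
    ((lim (hX.add hZ) h1).sub (lim hZ h1)) fun n => by
      have hn := key n
      rwa [show Y + Z + ε n • 1 + ε n • X + X = X + Y + Z + ε n • (1 + X) by rw [smul_add]; abel,
        show Y + Z + ε n • 1 + ε n • X = Y + Z + ε n • (1 + X) by rw [smul_add]; abel,
        show Z + ε n • 1 + X = X + Z + ε n • 1 by abel] at hn
  linarith
end

section
/- For every p ∈ (0,1] and all m×m real symmetric positive semidefinite matrices X, Y, Z, one has trace((X+Y+Z)^p) + trace(Z^p) ≤ trace((X+Z)^p) + trace((Y+Z)^p), where for a positive semidefinite matrix A, A^p denotes the matrix power defined via the spectral decomposition (each eigenvalue raised to the power p). -/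
open MeasureTheory in
theorem integrableOn_rpow_mul_log_one_add_inv {p : ℝ} (hp₀ : 0 < p) (hp₁ : p < 1) :
    IntegrableOn (fun t : ℝ => t ^ (p - 1) * Real.log (1 + t⁻¹)) (Set.Ioi 0) := by
  have hmeas : Measurable fun t : ℝ => t ^ (p - 1) * Real.log (1 + t⁻¹) := by fun_prop
  have hnonneg : ∀ t : ℝ, 0 < t → 0 ≤ t ^ (p - 1) * Real.log (1 + t⁻¹) := fun t ht =>
    mul_nonneg (by positivity) (Real.log_nonneg (by simp [ht.le]))
  rw [← Set.Ioc_union_Ioi_eq_Ioi zero_le_one, integrableOn_union]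
  constructor
  · have hint : IntegrableOn (fun t : ℝ => 2 ^ (p / 2) / (p / 2) * t ^ (p / 2 - 1))
        (Set.Ioc 0 1) := by
      refine Integrable.const_mul ?_ _
      exact (intervalIntegrable_iff_integrableOn_Ioc_of_le zero_le_one).1
        (intervalIntegral.intervalIntegrable_rpow' (by linarith))
    refine hint.mono' hmeas.aestronglyMeasurable ?_
    filter_upwards [ae_restrict_mem measurableSet_Ioc] with t ht
    have ht₀ : 0 < t := ht.1
    rw [Real.norm_of_nonneg (hnonneg t ht₀)]
    have h1 : 1 ≤ t⁻¹ := (one_le_inv₀ ht₀).2 ht.2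
    calc t ^ (p - 1) * Real.log (1 + t⁻¹)
        ≤ t ^ (p - 1) * Real.log (2 * t⁻¹) := by
          gcongr
          linarith
      _ ≤ t ^ (p - 1) * ((2 * t⁻¹) ^ (p / 2) / (p / 2)) := by
          gcongr
          exact Real.log_le_rpow_div (by positivity) (by positivity)
      _ = 2 ^ (p / 2) / (p / 2) * t ^ (p / 2 - 1) := by
          rw [Real.mul_rpow (by norm_num) (by positivity), Real.inv_rpow ht₀.le,
            ← Real.rpow_neg ht₀.le, show p / 2 - 1 = (p - 1) + -(p / 2) by ring,
            Real.rpow_add ht₀]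
          ring
  · refine (integrableOn_Ioi_rpow_of_lt (show p - 2 < -1 by linarith) zero_lt_one).mono'
      hmeas.aestronglyMeasurable ?_
    filter_upwards [ae_restrict_mem measurableSet_Ioi] with t ht
    have ht₀ : 0 < t := zero_lt_one.trans ht
    rw [Real.norm_of_nonneg (hnonneg t ht₀)]
    calc t ^ (p - 1) * Real.log (1 + t⁻¹) ≤ t ^ (p - 1) * t⁻¹ := by
          gcongr
          linarith [Real.log_le_sub_one_of_pos (show 0 < 1 + t⁻¹ by positivity)]
      _ = t ^ (p - 2) := by
          rw [← Real.rpow_neg_one t, ← Real.rpow_add ht₀]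
          ring_nf

open MeasureTheory in
theorem integral_rpow_mul_log_one_add_inv_pos {p : ℝ} (hp₀ : 0 < p) (hp₁ : p < 1) :
    0 < ∫ t in Set.Ioi (0 : ℝ), t ^ (p - 1) * Real.log (1 + t⁻¹) := by
  have hpos : ∀ t : ℝ, t ∈ Set.Ioi (0 : ℝ) → 0 < t ^ (p - 1) * Real.log (1 + t⁻¹) :=
    fun t ht => mul_pos (Real.rpow_pos_of_pos ht _) (Real.log_pos (by simpa using ht))
  rw [setIntegral_pos_iff_support_of_nonneg_ae
    ((ae_restrict_mem measurableSet_Ioi).mono fun t ht => (hpos t ht).le)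
    (integrableOn_rpow_mul_log_one_add_inv hp₀ hp₁),
    Set.inter_eq_right.2 fun t ht => Function.mem_support.2 (hpos t ht).ne']
  simp

open MeasureTheory in
theorem integrableOn_rpow_mul_log_one_add_div {p : ℝ} (hp₀ : 0 < p) (hp₁ : p < 1) {x : ℝ}
    (hx : 0 ≤ x) :
    IntegrableOn (fun t : ℝ => t ^ (p - 1) * Real.log (1 + x / t)) (Set.Ioi 0) := by
  rcases hx.eq_or_lt with rfl | hx
  · simp
  have h := (integrableOn_Ioi_comp_mul_left_iff
    (fun t : ℝ => t ^ (p - 1) * Real.log (1 + t⁻¹)) 0 (inv_pos.2 hx)).2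
    (by simpa using integrableOn_rpow_mul_log_one_add_inv hp₀ hp₁)
  refine IntegrableOn.congr_fun (f := fun t : ℝ =>
    x ^ (p - 1) * ((x⁻¹ * t) ^ (p - 1) * Real.log (1 + (x⁻¹ * t)⁻¹))) (h.const_mul _) (fun t ht => ?_) measurableSet_Ioi
  have ht₀ : (0 : ℝ) < t := ht
  simp only [Real.mul_rpow (inv_nonneg.2 hx.le) ht₀.le, Real.inv_rpow hx.le, mul_inv, inv_inv,
    div_eq_mul_inv]
  field_simp

open MeasureTheory in
theorem integral_rpow_mul_log_one_add_div {p : ℝ} (hp₀ : 0 < p) {x : ℝ} (hx : 0 ≤ x) :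
    ∫ t in Set.Ioi (0 : ℝ), t ^ (p - 1) * Real.log (1 + x / t) =
      x ^ p * ∫ t in Set.Ioi (0 : ℝ), t ^ (p - 1) * Real.log (1 + t⁻¹) := by
  rcases hx.eq_or_lt with rfl | hx
  · simp [Real.zero_rpow hp₀.ne']
  have h := integral_comp_mul_left_Ioi
    (fun t : ℝ => t ^ (p - 1) * Real.log (1 + t⁻¹)) 0 (inv_pos.2 hx)
  rw [mul_zero, inv_inv, smul_eq_mul] at h
  rw [show x ^ p = x ^ (p - 1) * x by rw [← Real.rpow_add_one hx.ne']; simp, mul_assoc, ← h,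
    ← integral_const_mul]
  refine setIntegral_congr_fun measurableSet_Ioi fun t ht => ?_
  have ht₀ : (0 : ℝ) < t := ht
  simp only [Real.mul_rpow (inv_nonneg.2 hx.le) ht₀.le, Real.inv_rpow hx.le, mul_inv, inv_inv,
    div_eq_mul_inv]
  field_simp

namespace Matrix

variable {n : Type*} [Fintype n] [DecidableEq n]

theorem PosDef.dotProduct_inv_mulVec_antitone {A B : Matrix n n ℝ} (hA : A.PosDef)
    (hB : B.PosDef) (hAB : (B - A).PosSemidef) (v : n → ℝ) :
    v ⬝ᵥ B⁻¹ *ᵥ v ≤ v ⬝ᵥ A⁻¹ *ᵥ v := by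
  have hAw : A *ᵥ (A⁻¹ *ᵥ v) = v := by
    rw [mulVec_mulVec, mul_nonsing_inv _ hA.det_pos.ne'.isUnit, one_mulVec]
  have hBu : B *ᵥ (B⁻¹ *ᵥ v) = v := by
    rw [mulVec_mulVec, mul_nonsing_inv _ hB.det_pos.ne'.isUnit, one_mulVec]
  generalize A⁻¹ *ᵥ v = w at *
  generalize B⁻¹ *ᵥ v = u at *
  have h1 := hA.posSemidef.dotProduct_mulVec_nonneg (w - u)
  have h2 := hAB.dotProduct_mulVec_nonneg u
  have h3 : w ⬝ᵥ A *ᵥ u = u ⬝ᵥ v := by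
    rw [dotProduct_mulVec, ← mulVec_transpose, ← conjTranspose_eq_transpose_of_trivial,
      hA.isHermitian.eq, hAw, dotProduct_comm]
  simp only [star_trivial, mulVec_sub, sub_mulVec, sub_dotProduct, dotProduct_sub, hAw, hBu, h3]
    at h1 h2
  rw [dotProduct_comm v, dotProduct_comm v]
  linarith

theorem PosDef.det_add_vecMulVec {A : Matrix n n ℝ} (hA : A.PosDef) (v : n → ℝ) :
    (A + vecMulVec v v).det = A.det * (1 + v ⬝ᵥ A⁻¹ *ᵥ v) := by
  rw [vecMulVec_eq Unit, det_add_replicateCol_mul_replicateRow hA.det_pos.ne'.isUnit,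
    Matrix.mul_assoc, ← replicateCol_mulVec]
  simp

theorem det_add_mul_det_le {A B Y : Matrix n n ℝ} (hA : A.PosDef)
    (hB : B.PosDef) (hAB : (B - A).PosSemidef) (hY : Y.PosSemidef) :
    (B + Y).det * A.det ≤ (A + Y).det * B.det := by
  obtain ⟨k, v, rfl⟩ := posSemidef_iff_eq_sum_vecMulVec.1 hY
  simp only [star_trivial]
  have hpsd : ∀ s : Finset (Fin k), (∑ i ∈ s, vecMulVec (v i) (v i)).PosSemidef := fun s =>
    posSemidef_sum s fun i _ => by simpa using posSemidef_vecMulVec_self_star (v i)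
  induction (Finset.univ : Finset (Fin k)) using Finset.induction_on with
  | empty => simp [mul_comm]
  | insert i s hi ih =>
    have hAs := hA.add_posSemidef (hpsd s)
    have hBs := hB.add_posSemidef (hpsd s)
    rw [Finset.sum_insert hi, add_comm (vecMulVec _ _), ← add_assoc, ← add_assoc,
      hAs.det_add_vecMulVec, hBs.det_add_vecMulVec]
    have h := hAs.dotProduct_inv_mulVec_antitone hBs (by simpa using hAB) (v i)
    have h0 := hBs.inv.posSemidef.dotProduct_mulVec_nonneg (v i)
    rw [star_trivial] at h0
    have := mul_pos hAs.det_pos hB.det_pos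
    calc _ = ((B + ∑ i ∈ s, vecMulVec (v i) (v i)).det * A.det) *
          (1 + v i ⬝ᵥ (B + ∑ i ∈ s, vecMulVec (v i) (v i))⁻¹ *ᵥ v i) := by ring
      _ ≤ ((A + ∑ i ∈ s, vecMulVec (v i) (v i)).det * B.det) *
          (1 + v i ⬝ᵥ (A + ∑ i ∈ s, vecMulVec (v i) (v i))⁻¹ *ᵥ v i) := by gcongr
      _ = _ := by ring

theorem IsHermitian.det_add_smul_one {A : Matrix n n ℝ} (hA : A.IsHermitian) (t : ℝ) :
    (A + t • 1).det = ∏ i, (hA.eigenvalues i + t) := by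
  have h := congrArg (Polynomial.eval (-t)) hA.charpoly_eq
  rw [eval_charpoly, Polynomial.eval_prod] at h
  have h2 : scalar n (-t) - A = -(A + t • 1) := by
    ext i j
    by_cases hij : i = j <;> simp [hij, scalar_apply, sub_eq_add_neg, add_comm]
  rw [h2, det_neg] at h
  have h3 : ∏ i, (-1 * (hA.eigenvalues i + t)) = (-1) ^ Fintype.card n * (A + t • 1).det := by
    rw [h]
    refine Finset.prod_congr rfl fun i _ => ?_
    simp
    ring
  rw [Finset.prod_mul_distrib, Finset.prod_const, Finset.card_univ] at h3
  exact (mul_left_cancel₀ (pow_ne_zero _ (by norm_num)) h3).symm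

theorem PosSemidef.sum_log_one_add_eigenvalues_div {A : Matrix n n ℝ} (hA : A.PosSemidef)
    {t : ℝ} (ht : 0 < t) :
    ∑ i, Real.log (1 + hA.isHermitian.eigenvalues i / t) =
      Real.log (A + t • 1).det - Fintype.card n * Real.log t := by
  have hpos : ∀ i, 0 < hA.isHermitian.eigenvalues i + t := fun i =>
    add_pos_of_nonneg_of_pos (hA.eigenvalues_nonneg i) ht
  rw [hA.isHermitian.det_add_smul_one, Real.log_prod fun i _ => (hpos i).ne', ← nsmul_eq_mul,
    ← Finset.card_univ, ← Finset.sum_const, ← Finset.sum_sub_distrib]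
  refine Finset.sum_congr rfl fun i _ => ?_
  rw [← Real.log_div (hpos i).ne' ht.ne', add_div, div_self ht.ne', add_comm]

end Matrix

theorem trace_matFun {m : ℕ} (f : ℝ → ℝ) {A : Matrix (Fin m) (Fin m) ℝ} (hA : A.IsHermitian) :
    (matFun f A).trace = ∑ i, f (hA.eigenvalues i) := by
  rw [matFun, dif_pos hA, Matrix.trace_mul_cycle, Unitary.coe_star_mul_self, one_mul,
    Matrix.trace_diagonal]

open MeasureTheory in
theorem integral_sum_rpow_mul_log {p : ℝ} (hp₀ : 0 < p) (hp₁ : p < 1) {m : ℕ}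
    {A : Matrix (Fin m) (Fin m) ℝ} (hA : A.PosSemidef) :
    ∫ t in Set.Ioi (0 : ℝ), t ^ (p - 1) *
        ∑ i, Real.log (1 + hA.isHermitian.eigenvalues i / t) =
      (matFun (fun x => Real.rpow x p) A).trace *
        ∫ t in Set.Ioi (0 : ℝ), t ^ (p - 1) * Real.log (1 + t⁻¹) := by
  simp only [trace_matFun _ hA.isHermitian, Finset.mul_sum, Finset.sum_mul, Real.rpow_eq_pow]
  rw [integral_finsetSum _ fun i _ =>
    integrableOn_rpow_mul_log_one_add_div hp₀ hp₁ (hA.eigenvalues_nonneg i)]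
  exact Finset.sum_congr rfl fun i _ =>
    integral_rpow_mul_log_one_add_div hp₀ (hA.eigenvalues_nonneg i)

open MeasureTheory in
theorem integrableOn_sum_rpow_mul_log {p : ℝ} (hp₀ : 0 < p) (hp₁ : p < 1) {m : ℕ}
    {A : Matrix (Fin m) (Fin m) ℝ} (hA : A.PosSemidef) :
    IntegrableOn (fun t : ℝ => t ^ (p - 1) *
        ∑ i, Real.log (1 + hA.isHermitian.eigenvalues i / t)) (Set.Ioi 0) := by
  simp only [Finset.mul_sum]
  exact integrable_finsetSum _ fun i _ =>
    integrableOn_rpow_mul_log_one_add_div hp₀ hp₁ (hA.eigenvalues_nonneg i)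

open MeasureTheory in
theorem trace_rpow_add_add_le (p : ℝ) (hp : p ∈ Set.Ioc (0 : ℝ) 1)
    (m : ℕ) (X Y Z : Matrix (Fin m) (Fin m) ℝ)
    (hX : X.PosSemidef) (hY : Y.PosSemidef) (hZ : Z.PosSemidef) :
    (matFun (fun x => Real.rpow x p) (X + Y + Z)).trace +
        (matFun (fun x => Real.rpow x p) Z).trace ≤
      (matFun (fun x => Real.rpow x p) (X + Z)).trace +
        (matFun (fun x => Real.rpow x p) (Y + Z)).trace := by
  have hXZ := hX.add hZ
  have hYZ := hY.add hZ
  have hXYZ := (hX.add hY).add hZ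
  obtain ⟨hp₀, hp₁⟩ := hp
  rcases hp₁.eq_or_lt with rfl | hp₁
  · simp only [trace_matFun _ hXZ.isHermitian, trace_matFun _ hYZ.isHermitian,
      trace_matFun _ hXYZ.isHermitian, trace_matFun _ hZ.isHermitian, Real.rpow_eq_pow,
      Real.rpow_one]
    have htrace {A : Matrix (Fin m) (Fin m) ℝ} (hA : A.PosSemidef) :
        ∑ i, hA.isHermitian.eigenvalues i = A.trace :=
      hA.isHermitian.trace_eq_sum_eigenvalues.symm
    rw [htrace hXYZ, htrace hZ, htrace hXZ, htrace hYZ]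
    simp only [Matrix.trace_add]
    linarith
  refine le_of_mul_le_mul_right ?_ (integral_rpow_mul_log_one_add_inv_pos hp₀ hp₁)
  rw [add_mul, add_mul, ← integral_sum_rpow_mul_log hp₀ hp₁ hXYZ,
    ← integral_sum_rpow_mul_log hp₀ hp₁ hZ, ← integral_sum_rpow_mul_log hp₀ hp₁ hXZ,
    ← integral_sum_rpow_mul_log hp₀ hp₁ hYZ,
    ← integral_add (integrableOn_sum_rpow_mul_log hp₀ hp₁ hXYZ)
      (integrableOn_sum_rpow_mul_log hp₀ hp₁ hZ),
    ← integral_add (integrableOn_sum_rpow_mul_log hp₀ hp₁ hXZ)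
      (integrableOn_sum_rpow_mul_log hp₀ hp₁ hYZ)]
  refine setIntegral_mono_on
    ((integrableOn_sum_rpow_mul_log hp₀ hp₁ hXYZ).add (integrableOn_sum_rpow_mul_log hp₀ hp₁ hZ))
    ((integrableOn_sum_rpow_mul_log hp₀ hp₁ hXZ).add (integrableOn_sum_rpow_mul_log hp₀ hp₁ hYZ))
    measurableSet_Ioi fun t ht => ?_
  have ht₀ : 0 < t := ht
  have hdef {A : Matrix (Fin m) (Fin m) ℝ} (hA : A.PosSemidef) : (A + t • 1).PosDef :=
    Matrix.PosDef.posSemidef_add hA (Matrix.PosDef.one.smul ht₀)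
  have hdet := Matrix.det_add_mul_det_le (hdef hZ) (hdef hXZ) (Y := Y)
    (by simpa using hX) hY
  rw [show X + Z + t • 1 + Y = X + Y + Z + t • 1 by abel,
    show Z + t • 1 + Y = Y + Z + t • 1 by abel] at hdet
  have hlog := Real.log_le_log (mul_pos (hdef hXYZ).det_pos (hdef hZ).det_pos) hdet
  rw [Real.log_mul (hdef hXYZ).det_pos.ne' (hdef hZ).det_pos.ne',
    Real.log_mul (hdef hYZ).det_pos.ne' (hdef hXZ).det_pos.ne'] at hlog
  rw [← mul_add, ← mul_add, hXYZ.sum_log_one_add_eigenvalues_div ht₀,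
    hZ.sum_log_one_add_eigenvalues_div ht₀, hXZ.sum_log_one_add_eigenvalues_div ht₀,
    hYZ.sum_log_one_add_eigenvalues_div ht₀]
  gcongr ?_ * ?_
  linarith
end

section
/- Let p ∈ (0,1], let M₁,…,M_s be m×m real symmetric positive semidefinite matrices, let N ≤ s be a positive integer, and define φ_p(S) = trace((Σ_{i∈S} M_i)^p) for S ⊆ {1,…,s}. Let S₀ = ∅ and, for k = 0,…,N−1, let S_{k+1} = S_k ∪ {i_k} where i_k ∈ {1,…,s} \ S_k satisfies φ_p(S_k ∪ {i_k}) ≥ φ_p(S_k ∪ {j}) for every j ∈ {1,…,s} \ S_k (a greedy sequence). Then φ_p(S_N) ≥ (1 − (1 − 1/N)^N) · max{φ_p(S) : S ⊆ {1,…,s}, card(S) ≤ N}; in particular φ_p(S_N) ≥ (1 − 1/e) · max{φ_p(S) : card(S) ≤ N}. -/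
/-- `φ_p(S) = trace (∑_{i∈S} M_i)^p` for a subset `S` of `{1,…,s}`. -/
noncomputable def phiSet (p : ℝ) {m s : ℕ} (M : Fin s → Matrix (Fin m) (Fin m) ℝ)
    (S : Finset (Fin s)) : ℝ :=
  (matFun (fun x => Real.rpow x p) (∑ i ∈ S, M i)).trace

/-- `φ_p(w) = trace (∑_{i=1}^s w_i M_i)^p` for a weight vector `w`. -/
noncomputable def phiW (p : ℝ) {m s : ℕ} (M : Fin s → Matrix (Fin m) (Fin m) ℝ)
    (w : Fin s → ℝ) : ℝ :=
  (matFun (fun x => Real.rpow x p) (∑ i, w i • M i)).trace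

open Finset in
theorem greedy_le_of_submodular {α : Type*} [DecidableEq α] {f : Finset α → ℝ}
    (hf0 : f ∅ = 0) (hmono : ∀ A i, f A ≤ f (insert i A))
    (hsub : ∀ (A B : Finset α) (i : α), A ⊆ B → i ∉ B →
      f (insert i B) - f B ≤ f (insert i A) - f A)
    {N : ℕ} (hN : 0 < N) {S : ℕ → Finset α} (hS0 : S 0 = ∅)
    (hgreedy : ∀ k < N, ∃ i ∉ S k, S (k + 1) = insert i (S k) ∧
      ∀ j ∉ S k, f (insert j (S k)) ≤ f (insert i (S k)))
    {T : Finset α} (hT : T.card ≤ N) :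
    (1 - (1 - 1 / (N : ℝ)) ^ N) * f T ≤ f (S N) := by
  have hunion : ∀ A B : Finset α, f A ≤ f (A ∪ B) := by
    intro A B
    induction B using Finset.induction_on with
    | empty => simp
    | insert b B _ ih => rw [union_insert]; exact ih.trans (hmono _ _)
  have hN' : (1 : ℝ) ≤ N := by exact_mod_cast hN
  have hstep : ∀ k < N, f T - f (S (k + 1)) ≤ (1 - 1 / (N : ℝ)) * (f T - f (S k)) := by
    intro k hk
    obtain ⟨i, hi, hSk, hmax⟩ := hgreedy k hk
    have hgain : 0 ≤ f (S (k + 1)) - f (S k) := by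
      rw [hSk]; linarith [hmono (S k) i]
    have hadd : ∀ B : Finset α, f (S k ∪ B) ≤
        f (S k) + B.card * (f (S (k + 1)) - f (S k)) := by
      intro B
      induction B using Finset.induction_on with
      | empty => simp
      | insert b B hb ih =>
        rw [union_insert, card_insert_of_notMem hb]
        push_cast
        by_cases hbS : b ∈ S k ∪ B
        · rw [insert_eq_of_mem hbS]; linarith
        · have h1 := hsub (S k) (S k ∪ B) b subset_union_left hbS
          have h2 := hmax b (fun h => hbS (mem_union_left _ h))
          rw [← hSk] at h2
          linarith
    have h1 : f T ≤ f (S k) + N * (f (S (k + 1)) - f (S k)) := by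
      have h2 := hunion T (S k)
      rw [union_comm] at h2
      have h3 : (T.card : ℝ) ≤ N := by exact_mod_cast hT
      nlinarith [hadd T, mul_le_mul_of_nonneg_right h3 hgain]
    have h4 : 1 / (N : ℝ) * (f T - f (S k)) ≤ f (S (k + 1)) - f (S k) := by
      rw [one_div, inv_mul_le_iff₀ (by linarith)]; linarith
    linarith
  have hq : 0 ≤ 1 - 1 / (N : ℝ) := by
    rw [sub_nonneg, div_le_one (by linarith)]; exact hN'
  have hgap : ∀ k ≤ N, f T - f (S k) ≤ (1 - 1 / (N : ℝ)) ^ k * f T := by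
    intro k
    induction k with
    | zero => intro _; simp [hS0, hf0]
    | succ k ih =>
      intro hk
      calc f T - f (S (k + 1)) ≤ (1 - 1 / (N : ℝ)) * (f T - f (S k)) := hstep k hk
        _ ≤ (1 - 1 / (N : ℝ)) * ((1 - 1 / (N : ℝ)) ^ k * f T) :=
          mul_le_mul_of_nonneg_left (ih (by omega)) hq
        _ = _ := by ring
  linarith [hgap N le_rfl]

theorem integrableOn_log_one_add_mul_rpow {p : ℝ} (hp0 : 0 < p) (hp1 : p < 1) :
    MeasureTheory.IntegrableOn (fun u : ℝ => Real.log (1 + u) * u ^ (-p - 1)) (Set.Ioi 0) := by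
  have hmeas : Measurable (fun u : ℝ => Real.log (1 + u) * u ^ (-p - 1)) := by fun_prop
  rw [← Set.Ioc_union_Ioi_eq_Ioi (zero_le_one (α := ℝ))]
  refine MeasureTheory.IntegrableOn.union ?_ ?_
  · have hf_int : MeasureTheory.IntegrableOn (fun u : ℝ => u ^ (-p)) (Set.Ioc 0 1) := by
      rw [← intervalIntegrable_iff_integrableOn_Ioc_of_le zero_le_one]
      exact intervalIntegral.intervalIntegrable_rpow' (by linarith)
    refine hf_int.mono' hmeas.aestronglyMeasurable ?_
    filter_upwards [MeasureTheory.ae_restrict_mem measurableSet_Ioc] with u hu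
    have hu0 : 0 < u := hu.1
    have hlog : 0 ≤ Real.log (1 + u) := Real.log_nonneg (by linarith)
    rw [Real.norm_of_nonneg (by positivity)]
    have hle : Real.log (1 + u) ≤ u := by
      linarith [Real.log_le_sub_one_of_pos (show 0 < 1 + u by linarith)]
    calc Real.log (1 + u) * u ^ (-p - 1) ≤ u * u ^ (-p - 1) := by gcongr
      _ = u ^ (-p) := by
        rw [← Real.rpow_one_add' hu0.le (by linarith)]; congr 1; ring
  · have hf_int := (integrableOn_Ioi_rpow_of_lt (show -(p / 2) - 1 < -1 by linarith)
      zero_lt_one).const_mul (2 ^ (p / 2) / (p / 2))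
    refine hf_int.mono' hmeas.aestronglyMeasurable ?_
    filter_upwards [MeasureTheory.ae_restrict_mem measurableSet_Ioi] with u hu
    have hu1 : 1 < u := hu
    have hu0 : 0 < u := by linarith
    have hlog : 0 ≤ Real.log (1 + u) := Real.log_nonneg (by linarith)
    rw [Real.norm_of_nonneg (by positivity)]
    calc Real.log (1 + u) * u ^ (-p - 1)
        ≤ ((1 + u) ^ (p / 2) / (p / 2)) * u ^ (-p - 1) := by
          gcongr
          exact Real.log_le_rpow_div (by linarith) (by linarith)
      _ ≤ ((2 * u) ^ (p / 2) / (p / 2)) * u ^ (-p - 1) := by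
          gcongr
          linarith
      _ = 2 ^ (p / 2) / (p / 2) * u ^ (-(p / 2) - 1) := by
          rw [Real.mul_rpow two_pos.le hu0.le,
            show -(p / 2) - 1 = p / 2 + (-p - 1) by ring, Real.rpow_add hu0]
          ring

theorem integral_log_one_add_mul_rpow_pos {p : ℝ} (hp0 : 0 < p) (hp1 : p < 1) :
    0 < ∫ u in Set.Ioi (0 : ℝ), Real.log (1 + u) * u ^ (-p - 1) := by
  have hpos : ∀ u ∈ Set.Ioi (0 : ℝ), 0 < Real.log (1 + u) * u ^ (-p - 1) := fun u hu =>
    mul_pos (Real.log_pos (by linarith [Set.mem_Ioi.1 hu])) (Real.rpow_pos_of_pos hu _)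
  rw [MeasureTheory.setIntegral_pos_iff_support_of_nonneg_ae
    (by
      filter_upwards [MeasureTheory.ae_restrict_mem measurableSet_Ioi] with u hu
        using (hpos u hu).le)
    (integrableOn_log_one_add_mul_rpow hp0 hp1),
    Set.inter_eq_right.2 (fun u hu => Function.mem_support.2 (hpos u hu).ne')]
  simp

theorem log_one_add_mul_mul_rpow_eq (p : ℝ) {x u : ℝ} (hx : 0 < x) (hu : 0 < u) :
    Real.log (1 + u * x) * u ^ (-p - 1) =
      x ^ (p + 1) * (Real.log (1 + x * u) * (x * u) ^ (-p - 1)) := by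
  have h : x ^ (p + 1) * x ^ (-p - 1) = 1 := by
    rw [← Real.rpow_add hx]; simp
  rw [Real.mul_rpow hx.le hu.le, mul_comm u x]
  linear_combination -(Real.log (1 + x * u) * u ^ (-p - 1)) * h

theorem integrableOn_log_one_add_mul_mul_rpow {p x : ℝ} (hp0 : 0 < p) (hp1 : p < 1)
    (hx : 0 ≤ x) :
    MeasureTheory.IntegrableOn (fun u : ℝ => Real.log (1 + u * x) * u ^ (-p - 1))
      (Set.Ioi 0) := by
  rcases hx.eq_or_lt with rfl | hx
  · simp
  · refine MeasureTheory.IntegrableOn.congr_fun ?_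
      (fun u hu => (log_one_add_mul_mul_rpow_eq p hx (Set.mem_Ioi.1 hu)).symm) measurableSet_Ioi
    refine MeasureTheory.Integrable.const_mul ?_ _
    refine (MeasureTheory.integrableOn_Ioi_comp_mul_left_iff
      (fun u : ℝ => Real.log (1 + u) * u ^ (-p - 1)) 0 hx).2 ?_
    simpa using integrableOn_log_one_add_mul_rpow hp0 hp1

theorem integral_log_one_add_mul_mul_rpow {p x : ℝ} (hp0 : 0 < p) (hx : 0 ≤ x) :
    ∫ u in Set.Ioi (0 : ℝ), Real.log (1 + u * x) * u ^ (-p - 1) =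
      x ^ p * ∫ u in Set.Ioi (0 : ℝ), Real.log (1 + u) * u ^ (-p - 1) := by
  rcases hx.eq_or_lt with rfl | hx
  · simp [Real.zero_rpow hp0.ne']
  · rw [MeasureTheory.setIntegral_congr_fun measurableSet_Ioi
      (fun u hu => log_one_add_mul_mul_rpow_eq p hx (Set.mem_Ioi.1 hu)),
      MeasureTheory.integral_const_mul,
      MeasureTheory.integral_comp_mul_left_Ioi
        (fun u : ℝ => Real.log (1 + u) * u ^ (-p - 1)) 0 hx]
    rw [mul_zero, smul_eq_mul, ← mul_assoc, Real.rpow_add_one hx.ne', mul_inv_cancel_right₀ hx.ne']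

section Determinant

variable {n : Type*} [Fintype n] [DecidableEq n]

open Matrix

theorem Matrix.IsHermitian.det_one_add_smul {A : Matrix n n ℝ} (hA : A.IsHermitian) (u : ℝ) :
    (1 + u • A).det = ∏ i, (1 + u * hA.eigenvalues i) := by
  have h : 1 + u • A = Unitary.conjStarAlgAut ℝ _ hA.eigenvectorUnitary
      (diagonal fun i => 1 + u * hA.eigenvalues i) := by
    conv_lhs => rw [hA.spectral_theorem]
    rw [← map_one (Unitary.conjStarAlgAut ℝ (Matrix n n ℝ) hA.eigenvectorUnitary), ← map_smul,
      ← map_add]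
    congr 1
    rw [← diagonal_one, ← diagonal_smul, diagonal_add]
    rfl
  rw [h, Unitary.conjStarAlgAut_apply, det_mul_right_comm,
    Unitary.mul_star_self_of_mem (SetLike.coe_mem _), one_mul, det_diagonal]

theorem Matrix.PosSemidef.one_le_det_one_add {A : Matrix n n ℝ} (hA : A.PosSemidef) :
    1 ≤ (1 + A).det := by
  have h := hA.1.det_one_add_smul 1
  rw [one_smul] at h
  rw [h]
  exact Finset.one_le_prod fun i _ => by linarith [hA.eigenvalues_nonneg i]

open scoped MatrixOrder in
theorem Matrix.PosSemidef.exists_eq_conjTranspose_mul_self {A : Matrix n n ℝ}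
    (hA : A.PosSemidef) : ∃ L : Matrix n n ℝ, A = Lᴴ * L :=
  CStarAlgebra.nonneg_iff_eq_star_mul_self.mp hA.nonneg

theorem Matrix.PosDef.det_add_conjTranspose_mul_self {X : Matrix n n ℝ} (hX : X.PosDef)
    (L : Matrix n n ℝ) : (X + Lᴴ * L).det = X.det * (1 + L * X⁻¹ * Lᴴ).det := by
  have hdet : IsUnit X.det := hX.det_pos.ne'.isUnit
  rw [mul_assoc, det_one_add_mul_comm, ← det_mul, mul_add, mul_one, ← mul_assoc, ← mul_assoc,
    mul_nonsing_inv _ hdet, one_mul]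

theorem Matrix.PosDef.det_le_det_add {X D : Matrix n n ℝ} (hX : X.PosDef) (hD : D.PosSemidef) :
    X.det ≤ (X + D).det := by
  obtain ⟨L, rfl⟩ := hD.exists_eq_conjTranspose_mul_self
  rw [hX.det_add_conjTranspose_mul_self]
  exact le_mul_of_one_le_right hX.det_pos.le
    (hX.inv.posSemidef.mul_mul_conjTranspose_same L).one_le_det_one_add

theorem Matrix.PosDef.posSemidef_inv_sub_inv_add {X C : Matrix n n ℝ} (hX : X.PosDef)
    (hC : C.PosSemidef) : (X⁻¹ - (X + C)⁻¹).PosSemidef := by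
  have hXC : (X + C).PosDef := hX.add_posSemidef hC
  have hdX : IsUnit X.det := hX.det_pos.ne'.isUnit
  have hdXC : IsUnit (X + C).det := hXC.det_pos.ne'.isUnit
  set Z := (X + C)⁻¹ with hZ
  have hZC : Z * C = 1 - Z * X := by
    rw [eq_sub_iff_add_eq, ← mul_add, add_comm, nonsing_inv_mul _ hdXC]
  have hCZ : C * Z = 1 - X * Z := by
    rw [eq_sub_iff_add_eq, ← add_mul, add_comm, mul_nonsing_inv _ hdXC]
  have h : X⁻¹ - Z = Z * C * Zᴴ + Z * C * X⁻¹ * (Z * C)ᴴ := by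
    rw [conjTranspose_mul, hC.1.eq, hXC.inv.1.eq, hCZ, mul_assoc Z C Z, hCZ, hZC]
    simp only [mul_sub, sub_mul, mul_one, one_mul, mul_assoc, nonsing_inv_mul_cancel_left _ _ hdX,
      mul_nonsing_inv _ hdX]
    abel
  rw [h]
  exact (hC.mul_mul_conjTranspose_same Z).add (hX.inv.posSemidef.mul_mul_conjTranspose_same _)

theorem Matrix.PosDef.det_add_add_mul_det_le {X B C : Matrix n n ℝ} (hX : X.PosDef)
    (hB : B.PosSemidef) (hC : C.PosSemidef) :
    (X + C + B).det * X.det ≤ (X + B).det * (X + C).det := by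
  obtain ⟨L, rfl⟩ := hB.exists_eq_conjTranspose_mul_self
  have hXC : (X + C).PosDef := hX.add_posSemidef hC
  rw [hX.det_add_conjTranspose_mul_self, hXC.det_add_conjTranspose_mul_self]
  have h : (1 + L * (X + C)⁻¹ * Lᴴ).det ≤ (1 + L * X⁻¹ * Lᴴ).det := by
    have := (PosDef.one.add_posSemidef
      (hXC.inv.posSemidef.mul_mul_conjTranspose_same L)).det_le_det_add
      ((hX.posSemidef_inv_sub_inv_add hC).mul_mul_conjTranspose_same L)
    rwa [add_assoc, ← add_mul, ← mul_add, add_sub_cancel] at this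
  nlinarith [mul_le_mul_of_nonneg_left h (mul_pos hX.det_pos hXC.det_pos).le]

end Determinant

section TraceRpow

variable {m : ℕ} {p : ℝ}

theorem log_det_one_add_smul_mul_rpow {A : Matrix (Fin m) (Fin m) ℝ} (hA : A.PosSemidef)
    (p : ℝ) {u : ℝ} (hu : 0 < u) :
    Real.log (1 + u • A).det * u ^ (-p - 1) =
      ∑ i, Real.log (1 + u * hA.1.eigenvalues i) * u ^ (-p - 1) := by
  rw [hA.1.det_one_add_smul, Real.log_prod, Finset.sum_mul]
  intro i _
  have := mul_nonneg hu.le (hA.eigenvalues_nonneg i)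
  positivity

theorem integrableOn_log_det_one_add_smul_mul_rpow {A : Matrix (Fin m) (Fin m) ℝ}
    (hA : A.PosSemidef) (hp0 : 0 < p) (hp1 : p < 1) :
    MeasureTheory.IntegrableOn (fun u : ℝ => Real.log (1 + u • A).det * u ^ (-p - 1))
      (Set.Ioi 0) := by
  refine MeasureTheory.IntegrableOn.congr_fun ?_
    (fun u hu => (log_det_one_add_smul_mul_rpow hA p (Set.mem_Ioi.1 hu)).symm) measurableSet_Ioi
  exact MeasureTheory.integrable_finsetSum _ fun i _ =>
    integrableOn_log_one_add_mul_mul_rpow hp0 hp1 (hA.eigenvalues_nonneg i)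

theorem integral_log_det_one_add_smul_mul_rpow {A : Matrix (Fin m) (Fin m) ℝ}
    (hA : A.PosSemidef) (hp0 : 0 < p) (hp1 : p < 1) :
    ∫ u in Set.Ioi (0 : ℝ), Real.log (1 + u • A).det * u ^ (-p - 1) =
      (matFun (fun x => Real.rpow x p) A).trace *
        ∫ u in Set.Ioi (0 : ℝ), Real.log (1 + u) * u ^ (-p - 1) := by
  rw [MeasureTheory.setIntegral_congr_fun measurableSet_Ioi
    (fun u hu => log_det_one_add_smul_mul_rpow hA p (Set.mem_Ioi.1 hu)),
    MeasureTheory.integral_finsetSum _ fun i _ =>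
      integrableOn_log_one_add_mul_mul_rpow hp0 hp1 (hA.eigenvalues_nonneg i),
    trace_matFun _ hA.1, Finset.sum_mul]
  exact Finset.sum_congr rfl fun i _ =>
    integral_log_one_add_mul_mul_rpow hp0 (hA.eigenvalues_nonneg i)

theorem trace_matFun_rpow_one {A : Matrix (Fin m) (Fin m) ℝ} (hA : A.IsHermitian) :
    (matFun (fun x => Real.rpow x 1) A).trace = A.trace := by
  rw [trace_matFun _ hA, hA.trace_eq_sum_eigenvalues]
  simp

theorem trace_matFun_rpow_zero (hp0 : 0 < p) :
    (matFun (fun x => Real.rpow x p) (0 : Matrix (Fin m) (Fin m) ℝ)).trace = 0 := by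
  have h0 : (0 : Matrix (Fin m) (Fin m) ℝ).IsHermitian := Matrix.isHermitian_zero
  rw [trace_matFun _ h0, h0.eigenvalues_eq_zero_iff.2 rfl]
  simp [Real.zero_rpow hp0.ne']

theorem trace_matFun_rpow_le_add {A B : Matrix (Fin m) (Fin m) ℝ} (hA : A.PosSemidef)
    (hB : B.PosSemidef) (hp0 : 0 < p) (hp1 : p ≤ 1) :
    (matFun (fun x => Real.rpow x p) A).trace ≤
      (matFun (fun x => Real.rpow x p) (A + B)).trace := by
  rcases hp1.eq_or_lt with rfl | hp1
  · rw [trace_matFun_rpow_one hA.1, trace_matFun_rpow_one (hA.add hB).1, Matrix.trace_add]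
    linarith [hB.trace_nonneg]
  · refine le_of_mul_le_mul_right ?_ (integral_log_one_add_mul_rpow_pos hp0 hp1)
    rw [← integral_log_det_one_add_smul_mul_rpow hA hp0 hp1,
      ← integral_log_det_one_add_smul_mul_rpow (hA.add hB) hp0 hp1]
    refine MeasureTheory.setIntegral_mono_on
      (integrableOn_log_det_one_add_smul_mul_rpow hA hp0 hp1)
      (integrableOn_log_det_one_add_smul_mul_rpow (hA.add hB) hp0 hp1) measurableSet_Ioi ?_
    intro u hu
    have hu0 : 0 < u := hu
    have hX : (1 + u • A).PosDef := Matrix.PosDef.one.add_posSemidef (hA.smul hu0.le)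
    refine mul_le_mul_of_nonneg_right (Real.log_le_log hX.det_pos ?_) (by positivity)
    rw [smul_add, ← add_assoc]
    exact hX.det_le_det_add (hB.smul hu0.le)

theorem trace_matFun_rpow_add_add_le {A B C : Matrix (Fin m) (Fin m) ℝ} (hA : A.PosSemidef)
    (hB : B.PosSemidef) (hC : C.PosSemidef) (hp0 : 0 < p) (hp1 : p ≤ 1) :
    (matFun (fun x => Real.rpow x p) (A + C + B)).trace +
        (matFun (fun x => Real.rpow x p) A).trace ≤
      (matFun (fun x => Real.rpow x p) (A + B)).trace +
        (matFun (fun x => Real.rpow x p) (A + C)).trace := by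
  rcases hp1.eq_or_lt with rfl | hp1
  · rw [trace_matFun_rpow_one hA.1, trace_matFun_rpow_one (hA.add hB).1,
      trace_matFun_rpow_one (hA.add hC).1, trace_matFun_rpow_one ((hA.add hC).add hB).1]
    simp only [Matrix.trace_add]
    linarith
  · have hf_int {D : Matrix (Fin m) (Fin m) ℝ} (hD : D.PosSemidef) :=
      integrableOn_log_det_one_add_smul_mul_rpow hD hp0 hp1
    refine le_of_mul_le_mul_right ?_ (integral_log_one_add_mul_rpow_pos hp0 hp1)
    rw [add_mul, add_mul, ← integral_log_det_one_add_smul_mul_rpow hA hp0 hp1,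
      ← integral_log_det_one_add_smul_mul_rpow (hA.add hB) hp0 hp1,
      ← integral_log_det_one_add_smul_mul_rpow (hA.add hC) hp0 hp1,
      ← integral_log_det_one_add_smul_mul_rpow ((hA.add hC).add hB) hp0 hp1,
      ← MeasureTheory.integral_add (hf_int ((hA.add hC).add hB)) (hf_int hA),
      ← MeasureTheory.integral_add (hf_int (hA.add hB)) (hf_int (hA.add hC))]
    refine MeasureTheory.setIntegral_mono_on ((hf_int ((hA.add hC).add hB)).add (hf_int hA))
      ((hf_int (hA.add hB)).add (hf_int (hA.add hC))) measurableSet_Ioi ?_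
    intro u hu
    have hu0 : 0 < u := hu
    have hX : (1 + u • A).PosDef := Matrix.PosDef.one.add_posSemidef (hA.smul hu0.le)
    have hXB := hX.add_posSemidef (hB.smul hu0.le)
    have hXC := hX.add_posSemidef (hC.smul hu0.le)
    have hXCB := hXC.add_posSemidef (hB.smul hu0.le)
    simp only [smul_add, ← add_assoc, ← add_mul]
    rw [← Real.log_mul hXCB.det_pos.ne' hX.det_pos.ne',
      ← Real.log_mul hXB.det_pos.ne' hXC.det_pos.ne']
    exact mul_le_mul_of_nonneg_right
      (Real.log_le_log (mul_pos hXCB.det_pos hX.det_pos)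
        (hX.det_add_add_mul_det_le (hB.smul hu0.le) (hC.smul hu0.le))) (by positivity)

end TraceRpow

section PhiSet

variable {p : ℝ} {m s : ℕ} {M : Fin s → Matrix (Fin m) (Fin m) ℝ}

theorem phiSet_empty (hp0 : 0 < p) : phiSet p M ∅ = 0 := by
  rw [phiSet, Finset.sum_empty, trace_matFun_rpow_zero hp0]

theorem phiSet_le_insert (hp0 : 0 < p) (hp1 : p ≤ 1) (hM : ∀ i, (M i).PosSemidef)
    (A : Finset (Fin s)) (i : Fin s) : phiSet p M A ≤ phiSet p M (insert i A) := by
  by_cases hi : i ∈ A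
  · rw [Finset.insert_eq_of_mem hi]
  · rw [phiSet, phiSet, Finset.sum_insert hi, add_comm (M i)]
    exact trace_matFun_rpow_le_add (Matrix.posSemidef_sum _ fun i _ => hM i) (hM i) hp0 hp1

theorem phiSet_nonneg (hp0 : 0 < p) (hp1 : p ≤ 1) (hM : ∀ i, (M i).PosSemidef)
    (A : Finset (Fin s)) : 0 ≤ phiSet p M A := by
  induction A using Finset.induction_on with
  | empty => rw [phiSet_empty hp0]
  | insert i A _ ih => exact ih.trans (phiSet_le_insert hp0 hp1 hM A i)

theorem phiSet_insert_sub_le (hp0 : 0 < p) (hp1 : p ≤ 1) (hM : ∀ i, (M i).PosSemidef)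
    {A B : Finset (Fin s)} {i : Fin s} (hAB : A ⊆ B) (hi : i ∉ B) :
    phiSet p M (insert i B) - phiSet p M B ≤ phiSet p M (insert i A) - phiSet p M A := by
  have hsum (D : Finset (Fin s)) : (∑ j ∈ D, M j).PosSemidef :=
    Matrix.posSemidef_sum _ fun j _ => hM j
  have h := trace_matFun_rpow_add_add_le (hsum A) (hM i) (hsum (B \ A)) hp0 hp1
  rw [add_comm (∑ j ∈ A, M j) (∑ j ∈ B \ A, M j), Finset.sum_sdiff hAB] at h
  simp only [phiSet]
  rw [Finset.sum_insert hi, Finset.sum_insert fun h => hi (hAB h), add_comm (M i),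
    add_comm (M i)]
  linarith

end PhiSet

open Finset in
/-- Greedy `(1 - (1-1/N)^N) ≥ (1 - 1/e)` approximation for
maximizing `φ_p(S) = trace (∑_{i∈S} M_i)^p` over sets of cardinality at most
`N`: if `S 0 = ∅` and each `S (k+1)` is obtained from `S k` by inserting a
greedily chosen new element, then for every `T` of cardinality at most `N`,
`φ_p(S N) ≥ (1 - (1-1/N)^N) φ_p(T) ≥ (1 - 1/e) φ_p(T)`. -/
theorem greedy_approx_phiSet (p : ℝ) (hp : p ∈ Set.Ioc (0 : ℝ) 1)
    (m s N : ℕ) (hN : 0 < N) (hNs : N ≤ s)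
    (M : Fin s → Matrix (Fin m) (Fin m) ℝ) (hM : ∀ i, (M i).PosSemidef)
    (S : ℕ → Finset (Fin s)) (hS0 : S 0 = ∅)
    (hgreedy : ∀ k < N, ∃ i ∉ S k, S (k + 1) = insert i (S k) ∧
      ∀ j ∉ S k, phiSet p M (insert j (S k)) ≤ phiSet p M (insert i (S k))) :
    ∀ T : Finset (Fin s), T.card ≤ N →
      (1 - (1 - 1 / (N : ℝ)) ^ N) * phiSet p M T ≤ phiSet p M (S N) ∧
      (1 - (Real.exp 1)⁻¹) * phiSet p M T ≤ phiSet p M (S N) := by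
  obtain ⟨hp0, hp1⟩ := hp
  intro T hT
  have hmain := greedy_le_of_submodular (phiSet_empty hp0) (phiSet_le_insert hp0 hp1 hM)
    (fun A B i hAB hi => phiSet_insert_sub_le hp0 hp1 hM hAB hi) hN hS0 hgreedy hT
  refine ⟨hmain, le_trans ?_ hmain⟩
  have hnonneg : 0 ≤ phiSet p M T := phiSet_nonneg hp0 hp1 hM T
  have hexp := Real.one_sub_div_pow_le_exp_neg (n := N) (t := 1) (by exact_mod_cast hN)
  rw [Real.exp_neg] at hexp
  gcongr
end

section
/- Let p ∈ (0,1], let M₁,…,M_s be m×m real symmetric positive semidefinite matrices with Σ_{i=1}^s M_i positive definite, let N ≤ s be a positive integer with s ≥ 2, and let w* ∈ ℝ_{≥0}^s maximize φ_p(w) = trace((Σ_{i=1}^s w_i M_i)^p) over {w ∈ ℝ^s : w ≥ 0, Σ_i w_i ≤ N}. Let S ⊆ {1,…,s} be a set of N indices of the N largest coordinates of w*. If p ≤ 1 − (ln N)/(ln s), then φ_p(S) ≥ (N/s)^{1−p} · φ_p(w*), where φ_p(S) = trace((Σ_{i∈S} M_i)^p). -/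
open scoped MatrixOrder

theorem CFC.rpow_le_rpow_of_nonpos {A : Type*} [CStarAlgebra A] [PartialOrder A]
    [StarOrderedRing A] {q : ℝ} (hq : q ∈ Set.Icc (-1) 0) {a b : A} (ha : IsStrictlyPositive a)
    (hab : a ≤ b) : b ^ q ≤ a ^ q := by
  have hb : IsStrictlyPositive b :=
    (CStarAlgebra.isUnit_of_le a hab ha).isStrictlyPositive (ha.nonneg.trans hab)
  have h1 := CStarAlgebra.rpow_neg_one_le_rpow_neg_one hab ha
  have h2 := CFC.rpow_le_rpow (p := -q) ⟨by linarith [hq.2], by linarith [hq.1]⟩ h1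
  rwa [CFC.rpow_rpow _ _ _ (by norm_num), CFC.rpow_rpow _ _ _ (by norm_num), neg_one_mul,
    neg_neg] at h2

namespace Matrix
variable {n : Type*} [Fintype n] [DecidableEq n]

/-- Entrywise inclusion of real matrices into complex matrices, as a star algebra homomorphism. -/
noncomputable def ofRealStarAlgHom : Matrix n n ℝ →⋆ₐ[ℝ] Matrix n n ℂ :=
  { Complex.ofRealAm.mapMatrix with
    map_star' := fun A => by
      ext i j
      simp [star_eq_conjTranspose] }

theorem ofRealStarAlgHom_apply (A : Matrix n n ℝ) (i j : n) :
    ofRealStarAlgHom A i j = (A i j : ℂ) := rfl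

theorem continuous_ofRealStarAlgHom : Continuous (ofRealStarAlgHom (n := n)) :=
  continuous_matrix fun i j => Complex.continuous_ofReal.comp (continuous_apply_apply i j)

open scoped ComplexOrder in
theorem ofRealStarAlgHom_nonneg_iff {A : Matrix n n ℝ} : 0 ≤ ofRealStarAlgHom A ↔ 0 ≤ A := by
  constructor
  · intro h
    rw [nonneg_iff_posSemidef] at h ⊢
    refine .of_dotProduct_mulVec_nonneg ?_ fun x => ?_
    · ext i j
      have := congrFun (congrFun h.1 i) j
      simpa [conjTranspose_apply, ofRealStarAlgHom_apply] using this
    · have := h.dotProduct_mulVec_nonneg (fun i => (x i : ℂ))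
      have e : star (fun i => (x i : ℂ)) ⬝ᵥ (ofRealStarAlgHom A *ᵥ (fun i => (x i : ℂ)))
          = ((star x ⬝ᵥ (A *ᵥ x) : ℝ) : ℂ) := by
        simp [dotProduct, mulVec, ofRealStarAlgHom_apply]
      rw [e] at this
      exact_mod_cast this
  · intro h
    obtain ⟨B, rfl⟩ := CStarAlgebra.nonneg_iff_eq_star_mul_self.mp h
    rw [map_mul, map_star]
    exact star_mul_self_nonneg _

theorem ofRealStarAlgHom_le_iff {A B : Matrix n n ℝ} :
    ofRealStarAlgHom A ≤ ofRealStarAlgHom B ↔ A ≤ B := by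
  rw [← sub_nonneg, ← map_sub, ofRealStarAlgHom_nonneg_iff, sub_nonneg]

theorem cfc_rpow_antitone {q : ℝ} (hq : q ∈ Set.Icc (-1) 0) {A B : Matrix n n ℝ} (hA : A.PosDef)
    (hAB : A ≤ B) : cfc (fun x : ℝ => x ^ q) B ≤ cfc (fun x : ℝ => x ^ q) A := by
  open scoped Matrix.Norms.L2Operator in
  have hA0 : 0 ≤ A := nonneg_iff_posSemidef.2 hA.posSemidef
  have hB0 : 0 ≤ B := hA0.trans hAB
  have key : ∀ X : Matrix n n ℝ, 0 ≤ X →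
      ofRealStarAlgHom (cfc (fun x : ℝ => x ^ q) X) = (ofRealStarAlgHom X) ^ q := by
    intro X hX
    have hX' := ofRealStarAlgHom_nonneg_iff.2 hX
    rw [CFC.rpow_eq_cfc_real hX']
    exact StarAlgHomClass.map_cfc ofRealStarAlgHom _ X
      (finite_real_spectrum.continuousOn _) continuous_ofRealStarAlgHom hX.isSelfAdjoint
      hX'.isSelfAdjoint
  have hpos : IsStrictlyPositive (ofRealStarAlgHom A) :=
    (hA.isUnit.map ofRealStarAlgHom).isStrictlyPositive (ofRealStarAlgHom_nonneg_iff.2 hA0)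
  rw [← ofRealStarAlgHom_le_iff, key _ hA0, key _ hB0]
  exact CFC.rpow_le_rpow_of_nonpos hq hpos (ofRealStarAlgHom_le_iff.2 hAB)

theorem exists_pos_smul_one_le {A : Matrix n n ℝ} (hA : A.PosDef) :
    ∃ r : ℝ, 0 < r ∧ r • (1 : Matrix n n ℝ) ≤ A := by
  rcases isEmpty_or_nonempty n with h | h
  · exact ⟨1, one_pos, le_of_eq (Subsingleton.elim _ _)⟩
  obtain ⟨r, hr, h⟩ := (CFC.exists_pos_algebraMap_le_iff (a := A) hA.1).2
    fun x hx => hA.isStrictlyPositive.spectrum_pos hx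
  exact ⟨r, hr, by rwa [Algebra.algebraMap_eq_smul_one] at h⟩

theorem exists_le_smul_one {A : Matrix n n ℝ} (hA : A.IsHermitian) :
    ∃ r : ℝ, 0 < r ∧ A ≤ r • (1 : Matrix n n ℝ) := by
  obtain ⟨c, hc⟩ := (finite_real_spectrum (A := A)).bddAbove
  refine ⟨max c 1, by positivity, ?_⟩
  rw [← Algebra.algebraMap_eq_smul_one, le_algebraMap_iff_spectrum_le hA]
  exact fun x hx => (hc hx).trans (le_max_left _ _)

theorem trace_mul_nonneg {P Q : Matrix n n ℝ} (hP : 0 ≤ P) (hQ : 0 ≤ Q) : 0 ≤ (P * Q).trace := by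
  obtain ⟨B, rfl⟩ := CStarAlgebra.nonneg_iff_eq_star_mul_self.mp hP
  rw [mul_assoc, trace_mul_comm]
  exact (nonneg_iff_posSemidef.1 (star_right_conjugate_nonneg hQ B)).trace_nonneg

theorem exists_trace_cfc_mul_cfc {X Y : Matrix n n ℝ} (hX : X.IsHermitian) (hY : Y.IsHermitian) :
    ∃ u : n → n → ℝ, (∀ j k, 0 ≤ u j k) ∧ ∀ f g : ℝ → ℝ,
      (cfc f X * cfc g Y).trace =
        ∑ j, ∑ k, u j k * (f (hX.eigenvalues j) * g (hY.eigenvalues k)) := by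
  let U : Matrix n n ℝ := hX.eigenvectorUnitary
  let V : Matrix n n ℝ := hY.eigenvectorUnitary
  refine ⟨fun j k => ((star U * V) j k) ^ 2, fun _ _ => sq_nonneg _, fun f g => ?_⟩
  rw [hX.cfc_eq, hY.cfc_eq, IsHermitian.cfc, IsHermitian.cfc, Unitary.conjStarAlgAut_apply,
    Unitary.conjStarAlgAut_apply]
  change (U * diagonal (f ∘ hX.eigenvalues) * star U *
    (V * diagonal (g ∘ hY.eigenvalues) * star V)).trace = _
  rw [trace_mul_comm, show V * diagonal (g ∘ hY.eigenvalues) * star V *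
      (U * diagonal (f ∘ hX.eigenvalues) * star U) = (V * diagonal (g ∘ hY.eigenvalues) *
      (star V * U * diagonal (f ∘ hX.eigenvalues) * star U)) by simp only [mul_assoc],
    trace_mul_comm, trace]
  have hs : star V * U = star (star U * V) := by simp
  have e : star V * U * diagonal (f ∘ hX.eigenvalues) * star U * (V * diagonal (g ∘ hY.eigenvalues))
    = star (star U * V) * diagonal (f ∘ hX.eigenvalues) * (star U * V) *
      diagonal (g ∘ hY.eigenvalues) := by rw [← hs]; simp only [mul_assoc]
  rw [e, Finset.sum_comm]
  refine Finset.sum_congr rfl fun k _ => ?_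
  rw [diag_apply, mul_diagonal, mul_apply, Finset.sum_mul]
  refine Finset.sum_congr rfl fun j _ => ?_
  rw [mul_diagonal, star_apply]
  simp only [Function.comp_apply, star_trivial]
  ring


theorem trace_cfc {X : Matrix n n ℝ} (hX : X.IsHermitian) (f : ℝ → ℝ) :
    (cfc f X).trace = ∑ i, f (hX.eigenvalues i) := by
  rw [hX.cfc_eq, IsHermitian.cfc, Unitary.conjStarAlgAut_apply, trace_mul_cycle]
  simp [trace]

/-- The sum of the `p`-th powers of the eigenvalues. -/
noncomputable def traceRpow (p : ℝ) (X : Matrix n n ℝ) : ℝ := (cfc (fun x : ℝ => x ^ p) X).trace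

theorem traceRpow_nonneg (p : ℝ) {X : Matrix n n ℝ} (hX : 0 ≤ X) : 0 ≤ traceRpow p X := by
  have h := nonneg_iff_posSemidef.1 hX
  rw [traceRpow, trace_cfc h.1]
  exact Finset.sum_nonneg fun i _ => Real.rpow_nonneg (h.eigenvalues_nonneg i) _

theorem cfc_rpow_smul {c q : ℝ} (hc : 0 ≤ c) {X : Matrix n n ℝ} (hX : 0 ≤ X) :
    cfc (fun x : ℝ => x ^ q) (c • X) = c ^ q • cfc (fun x : ℝ => x ^ q) X := by
  have h := nonneg_iff_posSemidef.1 hX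
  rw [← cfc_comp_const_mul c _ X ((finite_real_spectrum.image _).continuousOn _) h.1.isSelfAdjoint,
    ← cfc_smul (c ^ q) _ X (finite_real_spectrum.continuousOn _)]
  refine cfc_congr fun x hx => ?_
  exact Real.mul_rpow hc (spectrum_nonneg_of_nonneg hX hx)

theorem traceRpow_smul (p : ℝ) {c : ℝ} (hc : 0 ≤ c) {X : Matrix n n ℝ} (hX : 0 ≤ X) :
    traceRpow p (c • X) = c ^ p * traceRpow p X := by
  rw [traceRpow, cfc_rpow_smul hc hX, trace_smul, traceRpow, smul_eq_mul]

theorem cfc_rpow_nonneg (q : ℝ) {X : Matrix n n ℝ} (hX : 0 ≤ X) :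
    0 ≤ cfc (fun x : ℝ => x ^ q) X :=
  cfc_nonneg fun _ hx => Real.rpow_nonneg (spectrum_nonneg_of_nonneg hX hx) _

theorem trace_mul_cfc_rpow_self (p : ℝ) {X : Matrix n n ℝ} (hX : X.PosDef) :
    (X * cfc (fun x : ℝ => x ^ (p - 1)) X).trace = traceRpow p X := by
  have h : X * cfc (fun x : ℝ => x ^ (p - 1)) X = cfc (fun x : ℝ => x ^ p) X := by
    nth_rw 1 [← cfc_id' ℝ X hX.1.isSelfAdjoint]
    rw [← cfc_mul _ _ X (finite_real_spectrum.continuousOn _) (finite_real_spectrum.continuousOn _)]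
    refine cfc_congr fun x hx => ?_
    have hx0 : 0 < x := hX.isStrictlyPositive.spectrum_pos hx
    nth_rw 1 [← Real.rpow_one x]
    rw [← Real.rpow_add hx0]
    congr 1
    ring
  rw [h, traceRpow]

theorem _root_.Real.rpow_le_tangent {p x y : ℝ} (hp0 : 0 ≤ p) (hp1 : p ≤ 1) (hx : 0 ≤ x)
    (hy : 0 < y) : x ^ p ≤ (1 - p) * y ^ p + p * (x * y ^ (p - 1)) := by
  have h := Real.geom_mean_le_arith_mean2_weighted hp0 (sub_nonneg.2 hp1) hx hy.le (by ring)
  have h2 := mul_le_mul_of_nonneg_right h (Real.rpow_nonneg hy.le (p - 1))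
  have e1 : y ^ (1 - p) * y ^ (p - 1) = 1 := by
    rw [← Real.rpow_add hy]
    simp
  have e2 : y * y ^ (p - 1) = y ^ p := by
    nth_rw 1 [← Real.rpow_one y]
    rw [← Real.rpow_add hy]
    congr 1
    ring
  rw [mul_assoc, e1, add_mul, mul_assoc (1 - p), e2] at h2
  linarith

/-- The tangent-plane bound for the concave function `X ↦ trace (X ^ p)`. -/
theorem traceRpow_le_tangent {p : ℝ} (hp0 : 0 ≤ p) (hp1 : p ≤ 1) {X Y : Matrix n n ℝ}
    (hX : 0 ≤ X) (hY : Y.PosDef) :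
    traceRpow p X ≤
      (1 - p) * traceRpow p Y + p * (X * cfc (fun x : ℝ => x ^ (p - 1)) Y).trace := by
  have hX' := nonneg_iff_posSemidef.1 hX
  obtain ⟨u, hu, h⟩ := exists_trace_cfc_mul_cfc hX'.1 hY.1
  have h1 := h (fun x => x ^ p) (fun _ => 1)
  have h2 := h (fun _ => 1) (fun x => x ^ p)
  have h3 := h (fun x => x) (fun x => x ^ (p - 1))
  rw [cfc_const_one ℝ Y hY.1.isSelfAdjoint, mul_one] at h1
  rw [cfc_const_one ℝ X hX'.1.isSelfAdjoint, one_mul] at h2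
  rw [cfc_id' ℝ X hX'.1.isSelfAdjoint] at h3
  rw [traceRpow, traceRpow, h1, h2, h3, Finset.mul_sum, Finset.mul_sum, ← Finset.sum_add_distrib]
  refine Finset.sum_le_sum fun j _ => ?_
  rw [Finset.mul_sum, Finset.mul_sum, ← Finset.sum_add_distrib]
  refine Finset.sum_le_sum fun k _ => ?_
  have := mul_le_mul_of_nonneg_left (Real.rpow_le_tangent hp0 hp1 (hX'.eigenvalues_nonneg j)
    (hY.eigenvalues_pos k)) (hu j k)
  linarith

theorem traceRpow_sub_ge_of_posDef {p τ : ℝ} (hp0 : 0 ≤ p) (hp1 : p ≤ 1) {X Y B : Matrix n n ℝ}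
    (hX : 0 ≤ X) (hXY : X ≤ Y) (hY : Y.PosDef) (hτ : 0 < τ) (hYB : Y ≤ τ • B) (hB : 0 ≤ B) :
    p * (τ ^ (p - 1) * ((Y - X) * cfc (fun x : ℝ => x ^ (p - 1)) B).trace) ≤
      traceRpow p Y - traceRpow p X := by
  have h1 := traceRpow_le_tangent hp0 hp1 hX hY
  have h2 := cfc_rpow_antitone (q := p - 1) ⟨by linarith, by linarith⟩ hY hYB
  rw [cfc_rpow_smul hτ.le hB] at h2
  have h3 := trace_mul_nonneg (sub_nonneg.2 hXY) (sub_nonneg.2 h2)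
  have h4 := mul_nonneg hp0 h3
  rw [mul_sub, trace_sub, mul_smul_comm, trace_smul, smul_eq_mul, sub_mul Y X (cfc _ Y), trace_sub,
    trace_mul_cfc_rpow_self p hY] at h4
  linarith

theorem traceRpow_add_smul_one (p ε : ℝ) {X : Matrix n n ℝ} (hX : X.IsHermitian) :
    traceRpow p (X + ε • 1) = ∑ i, (hX.eigenvalues i + ε) ^ p := by
  have e : X + ε • 1 = cfc (fun x => x + ε) X := by
    rw [cfc_add_const ε (fun x => x) X (finite_real_spectrum.continuousOn _) hX.isSelfAdjoint,
      cfc_id' ℝ X hX.isSelfAdjoint,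
      Algebra.algebraMap_eq_smul_one]
  rw [e, traceRpow, ← cfc_comp' _ _ X ((finite_real_spectrum.image _).continuousOn _)
    (finite_real_spectrum.continuousOn _) hX.isSelfAdjoint, trace_cfc hX]

theorem traceRpow_eq_sum (p : ℝ) {X : Matrix n n ℝ} (hX : X.IsHermitian) :
    traceRpow p X = ∑ i, hX.eigenvalues i ^ p := trace_cfc hX _

open Filter Topology in
/-- Integrated form of the operator monotonicity of the derivative of `X ↦ trace (X ^ p)`. -/
theorem traceRpow_sub_ge {p τ : ℝ} (hp0 : 0 < p) (hp1 : p ≤ 1) {X Y B : Matrix n n ℝ}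
    (hX : 0 ≤ X) (hXY : X ≤ Y) (hτ : 0 < τ) (hYB : Y ≤ τ • B) (hB : B.PosDef) :
    p * (τ ^ (p - 1) * ((Y - X) * cfc (fun x : ℝ => x ^ (p - 1)) B).trace) ≤
      traceRpow p Y - traceRpow p X := by
  have hX' := nonneg_iff_posSemidef.1 hX
  have hY' := nonneg_iff_posSemidef.1 (hX.trans hXY)
  have hB' := nonneg_iff_posSemidef.2 hB.posSemidef
  obtain ⟨b, hb, hbB⟩ := exists_pos_smul_one_le hB
  set G := ((Y - X) * cfc (fun x : ℝ => x ^ (p - 1)) B).trace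
  have key : ∀ ε : ℝ, 0 < ε → p * ((τ + ε / b) ^ (p - 1) * G) ≤
      traceRpow p Y + Fintype.card n * ε ^ p - traceRpow p X := by
    intro ε hε
    have hone : (0 : Matrix n n ℝ) ≤ 1 := zero_le_one
    have hε1 : (0 : Matrix n n ℝ) ≤ ε • 1 := smul_nonneg hε.le hone
    have hpd : (Y + ε • (1 : Matrix n n ℝ)).PosDef :=
      PosDef.posSemidef_add hY' (PosDef.one.smul hε)
    have hle : Y + ε • (1 : Matrix n n ℝ) ≤ (τ + ε / b) • B := by
      rw [add_smul]
      refine add_le_add hYB ?_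
      have := smul_le_smul_of_nonneg_left hbB (div_pos hε hb).le
      rwa [smul_smul, div_mul_cancel₀ _ hb.ne'] at this
    have h := traceRpow_sub_ge_of_posDef hp0.le hp1 (add_nonneg hX hε1)
      (add_le_add hXY le_rfl) hpd (by positivity) hle hB'
    rw [add_sub_add_right_eq_sub] at h
    have h1 : traceRpow p X ≤ traceRpow p (X + ε • 1) := by
      rw [traceRpow_add_smul_one p ε hX'.1, traceRpow_eq_sum p hX'.1]
      refine Finset.sum_le_sum fun i _ => ?_
      exact Real.rpow_le_rpow (hX'.eigenvalues_nonneg i) (by linarith) hp0.le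
    have h2 : traceRpow p (Y + ε • 1) ≤ traceRpow p Y + Fintype.card n * ε ^ p := by
      rw [traceRpow_add_smul_one p ε hY'.1, traceRpow_eq_sum p hY'.1, ← nsmul_eq_mul,
        ← Finset.card_univ, ← Finset.sum_const, ← Finset.sum_add_distrib]
      refine Finset.sum_le_sum fun i _ => ?_
      exact Real.rpow_add_le_add_rpow (hY'.eigenvalues_nonneg i) hε.le hp0.le hp1
    linarith
  have l1 : Tendsto (fun ε : ℝ => p * ((τ + ε / b) ^ (p - 1) * G)) (𝓝[>] 0)
      (𝓝 (p * (τ ^ (p - 1) * G))) := by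
    have : ContinuousAt (fun ε : ℝ => p * ((τ + ε / b) ^ (p - 1) * G)) 0 := by
      refine continuousAt_const.mul (ContinuousAt.mul ?_ continuousAt_const)
      refine ContinuousAt.rpow_const (by fun_prop) (Or.inl ?_)
      simpa using hτ.ne'
    have h := this.tendsto.mono_left (nhdsWithin_le_nhds (s := Set.Ioi 0))
    simpa using h
  have l2 : Tendsto (fun ε : ℝ => traceRpow p Y + Fintype.card n * ε ^ p - traceRpow p X) (𝓝[>] 0)
      (𝓝 (traceRpow p Y - traceRpow p X)) := by
    have : ContinuousAt
        (fun ε : ℝ => traceRpow p Y + Fintype.card n * ε ^ p - traceRpow p X) 0 := by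
      refine ContinuousAt.sub (continuousAt_const.add (continuousAt_const.mul ?_))
        continuousAt_const
      exact Real.continuousAt_rpow_const _ _ (Or.inr hp0.le)
    have h := this.tendsto.mono_left (nhdsWithin_le_nhds (s := Set.Ioi 0))
    simpa [Real.zero_rpow hp0.ne'] using h
  exact le_of_tendsto_of_tendsto l1 l2 (eventually_nhdsWithin_of_forall key)

theorem traceRpow_mono {p : ℝ} (hp0 : 0 < p) (hp1 : p ≤ 1) {X Y : Matrix n n ℝ}
    (hX : 0 ≤ X) (hXY : X ≤ Y) : traceRpow p X ≤ traceRpow p Y := by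
  obtain ⟨r, hr, hYr⟩ := exists_le_smul_one (nonneg_iff_posSemidef.1 (hX.trans hXY)).1
  have h := traceRpow_sub_ge hp0 hp1 hX hXY hr hYr PosDef.one
  have h2 := trace_mul_nonneg (sub_nonneg.2 hXY)
    (cfc_rpow_nonneg (p - 1) (zero_le_one (α := Matrix n n ℝ)))
  have : 0 ≤ p * (r ^ (p - 1) *
      ((Y - X) * cfc (fun x : ℝ => x ^ (p - 1)) (1 : Matrix n n ℝ)).trace) :=
    by positivity
  linarith

theorem _root_.Real.rpow_sub_le_tangent {p x y : ℝ} (hp0 : 0 ≤ p) (hp1 : p ≤ 1) (hx : 0 ≤ x)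
    (hy : 0 < y) : x ^ p - y ^ p ≤ p * ((x - y) * y ^ (p - 1)) := by
  have h := Real.rpow_le_tangent hp0 hp1 hx hy
  have e2 : y * y ^ (p - 1) = y ^ p := by
    nth_rw 1 [← Real.rpow_one y]
    rw [← Real.rpow_add hy]
    congr 1
    ring
  rw [sub_mul, e2]
  linarith

theorem rpow_min_sub_le {p r τ u : ℝ} (hp0 : 0 < p) (hp1 : p < 1) (hr0 : 0 < r) (hr1 : r < 1)
    (hτ : 0 < τ) (hu : 0 ≤ u) :
    r ^ (1 - p) * (u ^ (1 - p) * min 1 (u * τ) ^ p - u ^ (1 - p) * min 1 (u * (r * τ)) ^ p) ≤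
      p * (τ ^ (p - 1) * (min 1 (u * τ) - min 1 (u * (r * τ)))) := by
  rcases hu.eq_or_lt with rfl | hu
  · simp
  have hle : u * (r * τ) ≤ u * τ := by
    have : r * τ ≤ τ := by nlinarith
    gcongr
  rcases le_total 1 (u * (r * τ)) with h | h
  · rw [min_eq_left h, min_eq_left (h.trans hle)]
    simp
  rw [min_eq_right h]
  have ha : 0 < u * (r * τ) := by positivity
  have h1 := Real.rpow_sub_le_tangent hp0.le hp1.le
    (le_min zero_le_one (by positivity : 0 ≤ u * τ)) ha
  have e : r ^ (1 - p) * u ^ (1 - p) * (u * (r * τ)) ^ (p - 1) = τ ^ (p - 1) := by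
    rw [Real.mul_rpow hu.le (by positivity), Real.mul_rpow hr0.le hτ.le]
    have e1 : ∀ x : ℝ, 0 < x → x ^ (1 - p) * x ^ (p - 1) = 1 := fun x hx => by
      rw [← Real.rpow_add hx]
      simp
    calc _ = (r ^ (1 - p) * r ^ (p - 1)) * (u ^ (1 - p) * u ^ (p - 1)) * τ ^ (p - 1) := by ring
      _ = _ := by rw [e1 r hr0, e1 u hu]; ring
  have h2 := mul_le_mul_of_nonneg_left h1 (by positivity : 0 ≤ r ^ (1 - p) * u ^ (1 - p))
  calc _ = r ^ (1 - p) * u ^ (1 - p) * (min 1 (u * τ) ^ p - (u * (r * τ)) ^ p) := by ring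
    _ ≤ _ := h2
    _ = p * ((r ^ (1 - p) * u ^ (1 - p) * (u * (r * τ)) ^ (p - 1)) *
        (min 1 (u * τ) - u * (r * τ))) := by ring
    _ = _ := by rw [e]

open Filter Topology in
/-- Matrix version of the Hölder inequality
`∑ wᵢ^(1-p) aᵢ ≤ (∑ aᵢ)^p (∑ wᵢ aᵢ)^(1-p)`. -/
theorem sum_rpow_mul_trace_le_traceRpow_sum {ι : Type*} {p : ℝ} (hp0 : 0 < p) (hp1 : p < 1)
    (S : Finset ι) {M : ι → Matrix n n ℝ} (hM : ∀ i, 0 ≤ M i) {w : ι → ℝ} (hw : ∀ i, 0 ≤ w i)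
    {B : Matrix n n ℝ} (hB : B.PosDef) (hwB : ∑ i ∈ S, w i • M i ≤ B) :
    ∑ i ∈ S, w i ^ (1 - p) * (M i * cfc (fun x : ℝ => x ^ (p - 1)) B).trace ≤
      traceRpow p (∑ i ∈ S, M i) := by
  have hB' := nonneg_iff_posSemidef.2 hB.posSemidef
  set g : ι → ℝ := fun i => (M i * cfc (fun x : ℝ => x ^ (p - 1)) B).trace with hg
  have hg0 : ∀ i, 0 ≤ g i := fun i => trace_mul_nonneg (hM i) (cfc_rpow_nonneg _ hB')
  set X : ℝ → Matrix n n ℝ := fun τ => ∑ i ∈ S, min 1 (w i * τ) • M i with hXdef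
  set Ψ : ℝ → ℝ := fun τ => ∑ i ∈ S, w i ^ (1 - p) * min 1 (w i * τ) ^ p * g i with hΨ
  have hX0 : ∀ τ, 0 ≤ τ → 0 ≤ X τ := fun τ hτ => Finset.sum_nonneg fun i _ =>
    smul_nonneg (le_min zero_le_one (mul_nonneg (hw i) hτ)) (hM i)
  have hstep : ∀ r τ, 0 < r → r < 1 → 0 < τ →
      r ^ (1 - p) * (Ψ τ - Ψ (r * τ)) ≤ traceRpow p (X τ) - traceRpow p (X (r * τ)) := by
    intro r τ hr0 hr1 hτ
    have hXX : X (r * τ) ≤ X τ := by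
      refine Finset.sum_le_sum fun i _ => smul_le_smul_of_nonneg_right ?_ (hM i)
      refine min_le_min le_rfl (mul_le_mul_of_nonneg_left ?_ (hw i))
      nlinarith
    have hXB : X τ ≤ τ • B := by
      refine le_trans ?_ (smul_le_smul_of_nonneg_left hwB hτ.le)
      rw [Finset.smul_sum]
      refine Finset.sum_le_sum fun i _ => ?_
      rw [smul_smul, mul_comm τ]
      exact smul_le_smul_of_nonneg_right (min_le_right _ _) (hM i)
    refine le_trans ?_ (traceRpow_sub_ge hp0 hp1.le (hX0 _ (by positivity)) hXX hτ hXB hB)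
    have e : ((X τ - X (r * τ)) * cfc (fun x : ℝ => x ^ (p - 1)) B).trace =
        ∑ i ∈ S, (min 1 (w i * τ) - min 1 (w i * (r * τ))) * g i := by
      rw [hXdef, ← Finset.sum_sub_distrib, Finset.sum_mul, trace_sum]
      refine Finset.sum_congr rfl fun i _ => ?_
      rw [← sub_smul, smul_mul_assoc, trace_smul, smul_eq_mul]
    rw [e, hΨ, ← Finset.sum_sub_distrib, Finset.mul_sum, Finset.mul_sum, Finset.mul_sum]
    refine Finset.sum_le_sum fun i _ => ?_
    have := mul_le_mul_of_nonneg_right (rpow_min_sub_le hp0 hp1 hr0 hr1 hτ (hw i)) (hg0 i)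
    linarith
  obtain ⟨T, hT, hwT⟩ : ∃ T : ℝ, 0 < T ∧ ∀ i ∈ S, 0 < w i → 1 ≤ w i * T := by
    have hnn : ∀ i ∈ S, 0 ≤ (w i)⁻¹ := fun i _ => inv_nonneg.2 (hw i)
    refine ⟨1 + ∑ i ∈ S, (w i)⁻¹, by linarith [Finset.sum_nonneg hnn], fun i hi hwi => ?_⟩
    calc 1 = w i * (w i)⁻¹ := (mul_inv_cancel₀ hwi.ne').symm
      _ ≤ _ := mul_le_mul_of_nonneg_left
        (by linarith [Finset.single_le_sum hnn hi]) (hw i)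
  have hXT : traceRpow p (X T) ≤ traceRpow p (∑ i ∈ S, M i) := by
    refine traceRpow_mono hp0 hp1.le (hX0 T hT.le) (Finset.sum_le_sum fun i _ => ?_)
    simpa using smul_le_smul_of_nonneg_right (min_le_left 1 (w i * T)) (hM i)
  have hΨT : Ψ T = ∑ i ∈ S, w i ^ (1 - p) * g i := by
    refine Finset.sum_congr rfl fun i hi => ?_
    rcases (hw i).eq_or_lt with h | h
    · rw [← h, Real.zero_rpow (by linarith)]
      simp
    · rw [min_eq_left (hwT i hi h)]
      simp
  rw [← hΨT]
  refine le_trans ?_ hXT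
  have hiter : ∀ r, 0 < r → r < 1 → ∀ k : ℕ,
      r ^ (1 - p) * (Ψ T - Ψ (r ^ k * T)) ≤ traceRpow p (X T) - traceRpow p (X (r ^ k * T)) := by
    intro r hr0 hr1 k
    induction k with
    | zero => simp
    | succ k ih =>
      have h := hstep r (r ^ k * T) hr0 hr1 (by positivity)
      rw [← mul_assoc, ← pow_succ'] at h
      linarith
  have hr : ∀ r, 0 < r → r < 1 → r ^ (1 - p) * Ψ T ≤ traceRpow p (X T) := by
    intro r hr0 hr1
    have hc : ContinuousAt Ψ 0 := by
      refine tendsto_finsetSum _ fun i _ => ?_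
      refine ContinuousAt.mul (continuousAt_const.mul ?_) continuousAt_const
      exact ContinuousAt.rpow_const (by fun_prop) (Or.inr hp0.le)
    have hΨ0 : Ψ 0 = 0 := by simp [hΨ, Real.zero_rpow hp0.ne']
    have ht : Tendsto (fun k : ℕ => r ^ k * T) atTop (𝓝 0) := by
      simpa using (tendsto_pow_atTop_nhds_zero_of_lt_one hr0.le hr1).mul_const T
    have h1 : Tendsto (fun k : ℕ => r ^ (1 - p) * (Ψ T - Ψ (r ^ k * T))) atTop
        (𝓝 (r ^ (1 - p) * (Ψ T - 0))) := by
      rw [← hΨ0]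
      exact ((hc.tendsto.comp ht).const_sub _).const_mul _
    rw [sub_zero] at h1
    refine le_of_tendsto' h1 fun k => (hiter r hr0 hr1 k).trans ?_
    linarith [traceRpow_nonneg p (hX0 (r ^ k * T) (by positivity))]
  have h1 : Tendsto (fun r : ℝ => r ^ (1 - p) * Ψ T) (𝓝[<] 1) (𝓝 (Ψ T)) := by
    have : ContinuousAt (fun r : ℝ => r ^ (1 - p) * Ψ T) 1 :=
      (Real.continuousAt_rpow_const _ _ (Or.inl one_ne_zero)).mul continuousAt_const
    simpa using this.tendsto.mono_left (nhdsWithin_le_nhds (s := Set.Iio 1))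
  refine le_of_tendsto h1 ?_
  filter_upwards [Ioo_mem_nhdsLT (zero_lt_one (α := ℝ))] with r hr'
  exact hr r hr'.1 hr'.2

theorem exists_le_smul_of_posDef {A B : Matrix n n ℝ} (hA : A.IsHermitian) (hB : B.PosDef) :
    ∃ c : ℝ, 0 < c ∧ A ≤ c • B := by
  obtain ⟨r, hr, hAr⟩ := exists_le_smul_one hA
  obtain ⟨b, hb, hbB⟩ := exists_pos_smul_one_le hB
  refine ⟨r / b, by positivity, hAr.trans ?_⟩
  have := smul_le_smul_of_nonneg_left hbB (div_pos hr hb).le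
  rwa [smul_smul, div_mul_cancel₀ _ hb.ne'] at this

open Filter Topology in
/-- First-order optimality condition for `traceRpow` at a positive definite matrix. -/
theorem trace_mul_cfc_le_of_optimal {p : ℝ} (hp0 : 0 < p) (hp1 : p ≤ 1) {M B : Matrix n n ℝ}
    (hM : 0 ≤ M) (hB : B.PosDef)
    (hopt : ∀ δ : ℝ, 0 < δ → δ < 1 → traceRpow p ((1 - δ) • B + δ • M) ≤ traceRpow p B) :
    (M * cfc (fun x : ℝ => x ^ (p - 1)) B).trace ≤ traceRpow p B := by
  have hB' := nonneg_iff_posSemidef.2 hB.posSemidef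
  obtain ⟨c, hc, hMc⟩ := exists_le_smul_of_posDef (nonneg_iff_posSemidef.1 hM).1 hB
  set g := (M * cfc (fun x : ℝ => x ^ (p - 1)) B).trace
  have key : ∀ δ : ℝ, 0 < δ → δ < 1 →
      (1 + δ * c) ^ (p - 1) * g ≤ (1 - δ) ^ (p - 1) * traceRpow p B := by
    intro δ h0 h1
    have hle : (1 - δ) • B + δ • M ≤ (1 + δ * c) • B := by
      have h2 : (1 - δ) • B ≤ (1 : ℝ) • B := smul_le_smul_of_nonneg_right (by linarith) hB'
      rw [add_smul, mul_smul]
      exact add_le_add h2 (smul_le_smul_of_nonneg_left hMc h0.le)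
    have h := traceRpow_sub_ge hp0 hp1 (smul_nonneg (sub_nonneg.2 h1.le) hB')
      (le_add_of_nonneg_right (smul_nonneg h0.le hM)) (by positivity) hle hB
    rw [add_sub_cancel_left, smul_mul_assoc, trace_smul, smul_eq_mul,
      traceRpow_smul p (sub_nonneg.2 h1.le) hB'] at h
    have h3 := Real.rpow_sub_le_tangent hp0.le hp1 zero_le_one (sub_pos.2 h1)
    rw [Real.one_rpow] at h3
    have h4 := mul_le_mul_of_nonneg_right h3 (traceRpow_nonneg p hB')
    have h5 := hopt δ h0 h1
    have h6 : (p * δ) * ((1 + δ * c) ^ (p - 1) * g) ≤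
        (p * δ) * ((1 - δ) ^ (p - 1) * traceRpow p B) := by
      linarith
    exact le_of_mul_le_mul_left h6 (by positivity)
  have l1 : Tendsto (fun δ : ℝ => (1 + δ * c) ^ (p - 1) * g) (𝓝[>] 0) (𝓝 g) := by
    have : ContinuousAt (fun δ : ℝ => (1 + δ * c) ^ (p - 1) * g) 0 :=
      (ContinuousAt.rpow_const (by fun_prop) (Or.inl (by simp))).mul continuousAt_const
    simpa using this.tendsto.mono_left (nhdsWithin_le_nhds (s := Set.Ioi 0))
  have l2 : Tendsto (fun δ : ℝ => (1 - δ) ^ (p - 1) * traceRpow p B) (𝓝[>] 0)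
      (𝓝 (traceRpow p B)) := by
    have : ContinuousAt (fun δ : ℝ => (1 - δ) ^ (p - 1) * traceRpow p B) 0 :=
      (ContinuousAt.rpow_const (by fun_prop) (Or.inl (by simp))).mul continuousAt_const
    simpa using this.tendsto.mono_left (nhdsWithin_le_nhds (s := Set.Ioi 0))
  refine le_of_tendsto_of_tendsto l1 l2 ?_
  filter_upwards [Ioo_mem_nhdsGT (zero_lt_one (α := ℝ))] with δ hδ
  exact key δ hδ.1 hδ.2

open Filter Topology in
theorem posDef_of_optimal {p : ℝ} (hp0 : 0 < p) (hp1 : p < 1) {B E : Matrix n n ℝ}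
    (hB : 0 ≤ B) (hE : E.PosDef)
    (hopt : ∀ δ : ℝ, 0 < δ → δ < 1 → traceRpow p ((1 - δ) • B + δ • E) ≤ traceRpow p B) :
    B.PosDef := by
  have hB' := nonneg_iff_posSemidef.1 hB
  rw [hB'.1.posDef_iff_eigenvalues_pos]
  by_contra! hcon
  obtain ⟨i₀, hi₀⟩ := hcon
  replace hi₀ := le_antisymm hi₀ (hB'.eigenvalues_nonneg i₀)
  obtain ⟨e, he, heE⟩ := exists_pos_smul_one_le hE
  have key : ∀ η : ℝ, 0 < η → 1 ≤ η ^ (1 - p) * (traceRpow p B / e) := by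
    intro η hη
    have hpos : 0 < 1 + η / e := by positivity
    have hδ : 1 - (1 + η / e)⁻¹ = (1 + η / e)⁻¹ * (η / e) := by
      field_simp
      ring
    have hδ0 : 0 < 1 - (1 + η / e)⁻¹ := by rw [hδ]; positivity
    have h1 := hopt (1 - (1 + η / e)⁻¹) hδ0 (by linarith [inv_pos.2 hpos])
    have h2 : (1 + η / e)⁻¹ • (B + η • 1) ≤
        (1 - (1 - (1 + η / e)⁻¹)) • B + (1 - (1 + η / e)⁻¹) • E := by
      rw [sub_sub_cancel, hδ, smul_add, mul_smul]
      refine add_le_add le_rfl (smul_le_smul_of_nonneg_left ?_ (inv_pos.2 hpos).le)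
      have := smul_le_smul_of_nonneg_left heE (div_pos hη he).le
      rwa [smul_smul, div_mul_cancel₀ _ he.ne'] at this
    have hη1 : (0 : Matrix n n ℝ) ≤ B + η • 1 := add_nonneg hB (smul_nonneg hη.le zero_le_one)
    have h3 := (traceRpow_mono hp0 hp1.le (smul_nonneg (inv_pos.2 hpos).le hη1) h2).trans h1
    rw [traceRpow_smul p (inv_pos.2 hpos).le hη1, Real.inv_rpow hpos.le,
      inv_mul_le_iff₀ (by positivity)] at h3
    have h4 : traceRpow p B + η ^ p ≤ traceRpow p (B + η • 1) := by
      rw [traceRpow_add_smul_one p η hB'.1, traceRpow_eq_sum p hB'.1,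
        ← Finset.add_sum_erase _ _ (Finset.mem_univ i₀),
        ← Finset.add_sum_erase _ (fun i => (hB'.1.eigenvalues i + η) ^ p) (Finset.mem_univ i₀),
        hi₀, Real.zero_rpow hp0.ne', zero_add, zero_add, add_comm]
      refine add_le_add le_rfl (Finset.sum_le_sum fun i _ => ?_)
      exact Real.rpow_le_rpow (hB'.eigenvalues_nonneg i) (by linarith) hp0.le
    have h5 : (1 + η / e) ^ p ≤ 1 + η / e :=
      Real.rpow_le_self_of_one_le (by linarith [div_pos hη he]) hp1.le
    have h6 := mul_le_mul_of_nonneg_right h5 (traceRpow_nonneg p hB)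
    have h7 : η ^ p ≤ η * (traceRpow p B / e) := by
      have : η * (traceRpow p B / e) = η / e * traceRpow p B := by ring
      linarith
    have h8 : η ^ p * η ^ (1 - p) = η := by
      rw [← Real.rpow_add hη]
      simp
    have h9 : η ^ p * 1 ≤ η ^ p * (η ^ (1 - p) * (traceRpow p B / e)) := by
      rw [← mul_assoc, h8, mul_one]
      exact h7
    exact le_of_mul_le_mul_left h9 (by positivity)
  have l : Tendsto (fun η : ℝ => η ^ (1 - p) * (traceRpow p B / e)) (𝓝[>] 0) (𝓝 0) := by
    have : ContinuousAt (fun η : ℝ => η ^ (1 - p) * (traceRpow p B / e)) 0 :=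
      (Real.continuousAt_rpow_const _ _ (Or.inr (by linarith))).mul continuousAt_const
    have h := this.tendsto.mono_left (nhdsWithin_le_nhds (s := Set.Ioi 0))
    simpa [Real.zero_rpow (by linarith : 1 - p ≠ 0)] using h
  exact absurd (ge_of_tendsto l (eventually_nhdsWithin_of_forall key)) (by norm_num)

end Matrix

/-- Among `s` nonnegative numbers with mean `1`, the `q`-th powers of the `N` largest ones have
mean at least `1`, provided that `N ≤ s ^ q`. -/
theorem card_le_sum_rpow_largest {ι : Type*} [Fintype ι] [DecidableEq ι] {q : ℝ} (hq0 : 0 ≤ q)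
    (hq1 : q ≤ 1) (hs : 2 ≤ Fintype.card ι) {x : ι → ℝ} (hx : ∀ i, 0 ≤ x i)
    (hsum : ∑ i, x i = Fintype.card ι) {S : Finset ι} (hS : S.Nonempty)
    (hSx : ∀ i ∈ S, ∀ j ∉ S, x j ≤ x i) (hSq : (S.card : ℝ) ≤ (Fintype.card ι : ℝ) ^ q) :
    (S.card : ℝ) ≤ ∑ i ∈ S, x i ^ q := by
  obtain ⟨i₀, hi₀, hmin⟩ := S.exists_min_image x hS
  set s : ℝ := (Fintype.card ι : ℝ) with hsdef
  set N : ℝ := (S.card : ℝ) with hNdef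
  have hs2 : (2 : ℝ) ≤ s := Nat.ofNat_le_cast.2 hs
  have hN1 : (1 : ℝ) ≤ N := Nat.one_le_cast.2 hS.card_pos
  have hNs : N ≤ s := Nat.cast_le.2 S.card_le_univ
  rcases le_or_gt 1 (x i₀) with h1 | h1
  · calc N = ∑ i ∈ S, (1 : ℝ) := by simp [hNdef]
      _ ≤ _ := Finset.sum_le_sum fun i hi => Real.one_le_rpow (h1.trans (hmin i hi)) hq0
  set d := 1 - x i₀ with hd
  have hd0 : 0 < d := by linarith
  set k := (N - 1) / (s - 1) with hk
  have hk0 : 0 ≤ k := div_nonneg (by linarith) (by linarith)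
  have hk1 : k ≤ 1 := (div_le_one (by linarith)).2 (by linarith)
  have hks : k * (s - 1) = N - 1 := div_mul_cancel₀ _ (by linarith)
  have hterm : ∀ i ∈ S, 1 + k * (x i - 1) - (1 - k) * max (1 - x i) 0 ≤ x i ^ q := by
    intro i _
    rcases le_total 1 (x i) with h | h
    · rw [max_eq_right (by linarith)]
      have hxs : x i ≤ s := hsum ▸ Finset.single_le_sum (fun j _ => hx j) (Finset.mem_univ i)
      have hs1 : 0 < s - 1 := by linarith
      set t := (x i - 1) / (s - 1) with ht
      have ht0 : 0 ≤ t := div_nonneg (by linarith) hs1.le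
      have ht1 : t ≤ 1 := (div_le_one hs1).2 (by linarith)
      have hts : t * (s - 1) = x i - 1 := div_mul_cancel₀ _ hs1.ne'
      have hc := (Real.concaveOn_rpow hq0 hq1).2 (Set.mem_Ici.2 zero_le_one)
        (Set.mem_Ici.2 (by linarith : 0 ≤ s)) (sub_nonneg.2 ht1) ht0 (by ring)
      simp only [smul_eq_mul, Real.one_rpow, mul_one] at hc
      rw [show 1 - t + t * s = x i by linarith] at hc
      have h2 := mul_le_mul_of_nonneg_left hSq ht0
      have h3 : k * (x i - 1) = t * (N - 1) := by rw [← hts, ← hks]; ring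
      linarith
    · rw [max_eq_left (by linarith)]
      have := Real.self_le_rpow_of_le_one (hx i) h hq1
      linarith
  refine le_trans ?_ (Finset.sum_le_sum hterm)
  rw [Finset.sum_sub_distrib, Finset.sum_add_distrib, ← Finset.mul_sum, ← Finset.mul_sum,
    Finset.sum_const, nsmul_eq_mul, mul_one]
  have hcompl : (s - N) * d ≤ ∑ i ∈ S, (x i - 1) := by
    have hz : ∑ i ∈ S, (x i - 1) + ∑ i ∈ Sᶜ, (x i - 1) = 0 := by
      rw [Finset.sum_add_sum_compl, Finset.sum_sub_distrib, hsum]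
      simp [hsdef]
    have hle : ∑ i ∈ Sᶜ, (x i - 1) ≤ ∑ _i ∈ Sᶜ, (-d) :=
      Finset.sum_le_sum fun j hj => by
        linarith [hSx i₀ hi₀ j (Finset.mem_compl.1 hj)]
    rw [Finset.sum_const, nsmul_eq_mul, Finset.card_compl, Nat.cast_sub S.card_le_univ] at hle
    linarith
  have hneg : ∑ i ∈ S, max (1 - x i) 0 ≤ (N - 1) * d := by
    obtain ⟨i₁, hi₁, hx₁⟩ : ∃ i ∈ S, 1 ≤ x i := by
      by_contra! hcon
      have : ∑ i, x i < ∑ _i : ι, (1 : ℝ) := by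
        refine Finset.sum_lt_sum_of_nonempty ⟨i₀, Finset.mem_univ _⟩ fun i _ => ?_
        by_cases hi : i ∈ S
        · exact hcon i hi
        · exact (hSx i₀ hi₀ i hi).trans_lt h1
      rw [hsum] at this
      simp [hsdef] at this
    rw [← Finset.add_sum_erase _ _ hi₁, max_eq_right (by linarith), zero_add]
    have hle : ∑ i ∈ S.erase i₁, max (1 - x i) 0 ≤ ∑ _i ∈ S.erase i₁, d :=
      Finset.sum_le_sum fun i hi =>
        max_le (by linarith [hmin i (Finset.mem_of_mem_erase hi)]) hd0.le
    rwa [Finset.sum_const, nsmul_eq_mul, Finset.card_erase_of_mem hi₁,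
      Nat.cast_sub hS.card_pos, Nat.cast_one] at hle
  have h1 := mul_le_mul_of_nonneg_left hcompl hk0
  have h2 := mul_le_mul_of_nonneg_left hneg (sub_nonneg.2 hk1)
  have h3 : k * ((s - N) * d) = (1 - k) * ((N - 1) * d) := by
    linear_combination d * hks
  linarith

open scoped MatrixOrder

theorem matFun_eq_cfc (f : ℝ → ℝ) {m : ℕ} {A : Matrix (Fin m) (Fin m) ℝ} (hA : A.IsHermitian) :
    matFun f A = cfc f A := by
  rw [matFun, dif_pos hA, hA.cfc_eq, Matrix.IsHermitian.cfc, Unitary.conjStarAlgAut_apply]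
  rfl

theorem trace_matFun_rpow (p : ℝ) {m : ℕ} {A : Matrix (Fin m) (Fin m) ℝ} (hA : 0 ≤ A) :
    (matFun (fun x => Real.rpow x p) A).trace = A.traceRpow p := by
  rw [matFun_eq_cfc _ (Matrix.nonneg_iff_posSemidef.1 hA).1]
  rfl

theorem Matrix.traceRpow_one {n : Type*} [Fintype n] [DecidableEq n] {A : Matrix n n ℝ}
    (hA : A.IsHermitian) : A.traceRpow 1 = A.trace := by
  simp only [traceRpow, Real.rpow_one]
  rw [cfc_id' ℝ A hA.isSelfAdjoint]

theorem sum_mul_le_of_forall_le {ι : Type*} [Fintype ι] [DecidableEq ι] {w t : ι → ℝ}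
    (hw : ∀ i, 0 ≤ w i) (hw1 : ∑ i, w i ≤ 1) (ht : ∀ i, 0 ≤ t i)
    (hmax : ∀ i, t i ≤ ∑ j, w j * t j) {i : ι} (hi : ∀ j, w j ≤ w i) :
    ∑ j, w j * t j ≤ t i := by
  set φ := ∑ j, w j * t j with hφ
  rcases (hw i).eq_or_lt with h0 | h0
  · have : φ = 0 := Finset.sum_eq_zero fun j _ => by
      rw [le_antisymm (h0 ▸ hi j) (hw j), zero_mul]
    rw [this]
    exact ht i
  have hφ0 : 0 ≤ φ := (ht i).trans (hmax i)
  have h1 : w i * (φ - t i) ≤ ∑ j, w j * (φ - t j) :=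
    Finset.single_le_sum (f := fun j => w j * (φ - t j))
      (fun j _ => mul_nonneg (hw j) (sub_nonneg.2 (hmax j))) (Finset.mem_univ i)
  have h2 : ∑ j, w j * (φ - t j) = (∑ j, w j) * φ - φ := by
    simp only [mul_sub, Finset.sum_sub_distrib, ← Finset.sum_mul, ← hφ]
  have h3 := mul_le_mul_of_nonneg_right hw1 hφ0
  nlinarith

/-- Prior approximation bound for the binary design obtained
by keeping the `N` largest coordinates of the optimal approximate design `w*`:
if `p ≤ 1 - (ln N)/(ln s)`, then `φ_p(S) ≥ (N/s)^{1-p} · φ_p(w*)`. -/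
theorem prior_bound_binary_rounding (p : ℝ) (hp : p ∈ Set.Ioc (0 : ℝ) 1)
    (m s : ℕ) (hs : 2 ≤ s) (M : Fin s → Matrix (Fin m) (Fin m) ℝ)
    (hM : ∀ i, (M i).PosSemidef) (hsum : (∑ i, M i).PosDef)
    (N : ℕ) (hN : 0 < N) (hNs : N ≤ s)
    (w : Fin s → ℝ) (hw0 : ∀ i, 0 ≤ w i) (hwN : ∑ i, w i ≤ N)
    (hopt : ∀ v : Fin s → ℝ, (∀ i, 0 ≤ v i) → (∑ i, v i ≤ N) →
      phiW p M v ≤ phiW p M w)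
    (S : Finset (Fin s)) (hScard : S.card = N)
    (hSlargest : ∀ i ∈ S, ∀ j ∉ S, w j ≤ w i)
    (hplog : p ≤ 1 - Real.log N / Real.log s) :
    Real.rpow ((N : ℝ) / s) (1 - p) * phiW p M w ≤ phiSet p M S := by
  obtain ⟨hp0, hp1⟩ := hp
  have hM0 : ∀ i, 0 ≤ M i := fun i => Matrix.nonneg_iff_posSemidef.2 (hM i)
  have hsum0 : ∀ v : Fin s → ℝ, (∀ i, 0 ≤ v i) → 0 ≤ ∑ i, v i • M i := fun v hv =>
    Finset.sum_nonneg fun i _ => smul_nonneg (hv i) (hM0 i)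
  have hphi : ∀ v : Fin s → ℝ, (∀ i, 0 ≤ v i) →
      phiW p M v = (∑ i, v i • M i).traceRpow p := fun v hv => trace_matFun_rpow p (hsum0 v hv)
  have hphiS : phiSet p M S = (∑ i ∈ S, M i).traceRpow p :=
    trace_matFun_rpow p (Finset.sum_nonneg fun i _ => hM0 i)
  have hNR : (0 : ℝ) < N := by exact_mod_cast hN
  have hsR : (2 : ℝ) ≤ s := by exact_mod_cast hs
  have hlogs : 0 < Real.log s := Real.log_pos (by linarith)
  have hNsq : (N : ℝ) ≤ (s : ℝ) ^ (1 - p) := by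
    have h : Real.log N / Real.log s ≤ 1 - p := by linarith
    rw [div_le_iff₀ hlogs] at h
    exact (Real.le_rpow_iff_log_le hNR (by linarith)).2 h
  rw [hphiS, hphi w hw0]
  change ((N : ℝ) / s) ^ (1 - p) * _ ≤ _
  have hS : S.Nonempty := Finset.card_pos.1 (hScard ▸ hN)
  rcases hp1.eq_or_lt with rfl | hp1
  · have hN1 : N = 1 := by
      rw [sub_self, Real.rpow_zero] at hNsq
      have : N ≤ 1 := by exact_mod_cast hNsq
      omega
    subst hN1
    obtain ⟨i, rfl⟩ := Finset.card_eq_one.1 hScard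
    have htr : ∀ v : Fin s → ℝ, (∀ i, 0 ≤ v i) →
        (∑ i, v i • M i).traceRpow 1 = ∑ i, v i * (M i).trace := fun v hv => by
      rw [Matrix.traceRpow_one (Matrix.nonneg_iff_posSemidef.1 (hsum0 v hv)).1, Matrix.trace_sum]
      simp only [Matrix.trace_smul, smul_eq_mul]
    rw [sub_self, Real.rpow_zero, one_mul, Finset.sum_singleton, Matrix.traceRpow_one (hM i).1,
      htr w hw0]
    refine sum_mul_le_of_forall_le hw0 (by simpa using hwN) (fun i => (hM i).trace_nonneg)
      (fun j => ?_) (fun j => ?_)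
    · have hv0 : ∀ i, 0 ≤ (Pi.single j 1 : Fin s → ℝ) i := fun i => by
        by_cases h : i = j <;> simp [h]
      have h := hopt (Pi.single j 1) hv0 (by simp)
      rw [hphi _ hv0, hphi _ hw0, htr _ hv0, htr _ hw0] at h
      simpa [Pi.single_apply] using h
    · by_cases h : j = i
      · rw [h]
      · exact hSlargest i (by simp) j (by simpa using h)
  set B := ∑ i, w i • M i with hBdef
  have hB0 : 0 ≤ B := hsum0 w hw0
  have hdir : ∀ v : Fin s → ℝ, (∀ i, 0 ≤ v i) → ∑ i, v i ≤ N → ∀ δ : ℝ, 0 < δ → δ < 1 →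
      ((1 - δ) • B + δ • ∑ i, v i • M i).traceRpow p ≤ B.traceRpow p := by
    intro v hv hvN δ h0 h1
    have hv' : ∀ i, 0 ≤ (1 - δ) * w i + δ * v i := fun i =>
      add_nonneg (mul_nonneg (by linarith) (hw0 i)) (mul_nonneg h0.le (hv i))
    have h := hopt (fun i => (1 - δ) * w i + δ * v i) hv' (by
      rw [Finset.sum_add_distrib, ← Finset.mul_sum, ← Finset.mul_sum]
      nlinarith)
    rw [hphi _ hv', hphi _ hw0] at h
    convert h using 2
    simp only [hBdef, add_smul, mul_smul, Finset.sum_add_distrib, ← Finset.smul_sum]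
  have hBpd : B.PosDef := by
    have hc : (0 : ℝ) < N / s := by positivity
    refine Matrix.posDef_of_optimal hp0 hp1 hB0 (hsum.smul hc) fun δ h0 h1 => ?_
    have h := hdir (fun _ => (N : ℝ) / s) (fun _ => hc.le) (by
      rw [Finset.sum_const, Finset.card_univ, Fintype.card_fin, nsmul_eq_mul,
        mul_div_cancel₀ _ (by linarith)]) δ h0 h1
    rwa [← Finset.smul_sum] at h
  set φ := B.traceRpow p
  have hφ0 : 0 ≤ φ := Matrix.traceRpow_nonneg p hB0
  set g : Fin s → ℝ := fun i => (M i * cfc (fun x : ℝ => x ^ (p - 1)) B).trace with hg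
  have hgle : ∀ i, N * g i ≤ φ := by
    intro i
    have h := Matrix.trace_mul_cfc_le_of_optimal hp0 hp1.le (smul_nonneg hNR.le (hM0 i)) hBpd
      fun δ h0 h1 => by
        have hv0 : ∀ j, 0 ≤ (Pi.single i (N : ℝ) : Fin s → ℝ) j := fun j => by
          by_cases h : j = i <;> simp [h]
        simpa [Pi.single_apply, ite_smul] using
          hdir (Pi.single i (N : ℝ)) hv0 (by simp) δ h0 h1
    rwa [smul_mul_assoc, Matrix.trace_smul, smul_eq_mul] at h
  have hwg : ∑ i, w i * g i = φ := by
    refine Eq.trans ?_ (Matrix.trace_mul_cfc_rpow_self p hBpd)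
    nth_rw 1 [hBdef]
    rw [Finset.sum_mul, Matrix.trace_sum]
    simp only [smul_mul_assoc, Matrix.trace_smul, smul_eq_mul, hg]
  have hsumw : ∑ i, w i * (φ - N * g i) = (∑ i, w i) * φ - N * φ := by
    simp only [mul_sub, Finset.sum_sub_distrib, ← Finset.sum_mul]
    congr 1
    rw [← hwg, Finset.mul_sum]
    exact Finset.sum_congr rfl fun i _ => by ring
  have hterm0 : ∀ i ∈ Finset.univ, 0 ≤ w i * (φ - N * g i) := fun i _ =>
    mul_nonneg (hw0 i) (sub_nonneg.2 (hgle i))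
  have hnn := Finset.sum_nonneg hterm0
  have hwφ := mul_le_mul_of_nonneg_right hwN hφ0
  rcases hφ0.eq_or_lt with hφ | hφ
  · rw [← hφ, mul_zero]
    exact Matrix.traceRpow_nonneg p (Finset.sum_nonneg fun i _ => hM0 i)
  have hwsum : ∑ i, w i = N :=
    le_antisymm hwN (le_of_mul_le_mul_right (by linarith) hφ)
  have hzero : ∀ i, w i = 0 ∨ g i = φ / N := by
    intro i
    have h := (Finset.sum_eq_zero_iff_of_nonneg hterm0).1 (by rw [hsumw, hwsum, sub_self]) i
      (Finset.mem_univ i)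
    rcases mul_eq_zero.1 h with h | h
    · exact Or.inl h
    · right
      rw [eq_div_iff hNR.ne']
      linarith
  have hmain := Matrix.sum_rpow_mul_trace_le_traceRpow_sum hp0 hp1 S hM0 hw0 hBpd
    (Finset.sum_le_univ_sum_of_nonneg fun i => smul_nonneg (hw0 i) (hM0 i))
  refine le_trans ?_ hmain
  have hrew : ∑ i ∈ S, w i ^ (1 - p) * g i = (∑ i ∈ S, w i ^ (1 - p)) * (φ / N) := by
    rw [Finset.sum_mul]
    refine Finset.sum_congr rfl fun i _ => ?_
    rcases hzero i with h | h
    · rw [h, Real.zero_rpow (by linarith), zero_mul, zero_mul]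
    · rw [h]
  change _ ≤ ∑ i ∈ S, w i ^ (1 - p) * g i
  rw [hrew]
  have hc : (0 : ℝ) < s / N := by positivity
  have hx := card_le_sum_rpow_largest (q := 1 - p) (by linarith) (by linarith)
    (by simpa using hs) (x := fun i => s / N * w i) (fun i => mul_nonneg hc.le (hw0 i))
    (by rw [← Finset.mul_sum, hwsum, Fintype.card_fin, div_mul_cancel₀ _ hNR.ne']) hS
    (fun i hi j hj => mul_le_mul_of_nonneg_left (hSlargest i hi j hj) hc.le)
    (by rwa [hScard, Fintype.card_fin])
  simp only [fun i => Real.mul_rpow (z := 1 - p) hc.le (hw0 i)] at hx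
  rw [← Finset.mul_sum, hScard, ← inv_div, Real.inv_rpow (by positivity),
    le_inv_mul_iff₀ (by positivity)] at hx
  calc ((N : ℝ) / s) ^ (1 - p) * φ = (((N : ℝ) / s) ^ (1 - p) * N) * (φ / N) := by
        field_simp
    _ ≤ _ := mul_le_mul_of_nonneg_right hx (by positivity)
end
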